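/- Every maximal planar graph on at least 4 vertices is 3-connected. -/

import Mathlib

noncomputable section

/-- The unit sphere `Σ` in `ℝ³`. -/
abbrev Sphere2 : Type := Metric.sphere (0 : EuclideanSpace ℝ (Fin 3)) 1

/-- `A` is a simple arc on the sphere from `x` to `y`. -/
def IsArc (A : Set Sphere2) (x y : Sphere2) : Prop :=
  ∃ f : ℝ → Sphere2, ContinuousOn f (Set.Icc 0 1) ∧ Set.InjOn f (Set.Icc 0 1) ∧
    f 0 = x ∧ f 1 = y ∧ f '' Set.Icc 0 1 = A

/-- A plane drawing (planar embedding) of a graph `G` in the sphere `Σ`: vertices are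
mapped to distinct points, edges to simple arcs between their end vertices, and arcs
do not cross, except in common end vertices. -/
structure SphereEmbedding {V : Type*} (G : SimpleGraph V) where
  pos : V → Sphere2
  arc : Sym2 V → Set Sphere2
  pos_inj : Function.Injective pos
  arc_isArc : ∀ e ∈ G.edgeSet, ∀ v w : V, e = s(v, w) → IsArc (arc e) (pos v) (pos w)
  arc_vertex : ∀ e ∈ G.edgeSet, ∀ v : V, pos v ∈ arc e → v ∈ e
  arc_inter : ∀ e ∈ G.edgeSet, ∀ e' ∈ G.edgeSet, e ≠ e' →
    arc e ∩ arc e' ⊆ {x | ∃ v : V, v ∈ e ∧ v ∈ e' ∧ pos v = x}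

/-- The point set of the drawing. -/
def SphereEmbedding.image {V : Type*} {G : SimpleGraph V} (D : SphereEmbedding G) :
    Set Sphere2 :=
  Set.range D.pos ∪ ⋃ e ∈ G.edgeSet, D.arc e

/-- A planar graph is a graph that admits a plane drawing. -/
def SimpleGraph.IsPlanar {V : Type*} (G : SimpleGraph V) : Prop :=
  Nonempty (SphereEmbedding G)

/-- A face of a plane drawing: a connected region of `Σ` minus the drawing. -/
def SphereEmbedding.IsFace {V : Type*} {G : SimpleGraph V} (D : SphereEmbedding G)
    (U : Set Sphere2) : Prop :=
  ∃ x ∈ D.imageᶜ, U = connectedComponentIn D.imageᶜ x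

/-- Two plane drawings of the same graph are equivalent (homeomorphic) if some
homeomorphism of the sphere maps vertices, edges (and hence faces) of the first
drawing onto vertices and edges of the second. -/
def SphereEmbedding.EquivEmb {V : Type*} {G : SimpleGraph V}
    (D₁ D₂ : SphereEmbedding G) : Prop :=
  ∃ (φ : Sphere2 ≃ₜ Sphere2) (σ : G ≃g G),
    (∀ v, φ (D₁.pos v) = D₂.pos (σ v)) ∧
    ∀ e ∈ G.edgeSet, φ '' D₁.arc e = D₂.arc (e.map σ)

/-- `G` is 3-connected: it has at least 4 vertices and deleting any at most two
vertices leaves it connected. -/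
def ThreeConnected {V : Type*} [Fintype V] (G : SimpleGraph V) : Prop :=
  4 ≤ Fintype.card V ∧
    ∀ s : Set V, s.ncard ≤ 2 → (((⊤ : G.Subgraph).deleteVerts s).coe).Connected

/-- `G` is maximal planar: planar, and no edge can be added keeping planarity. -/
def IsMaximalPlanar {V : Type*} (G : SimpleGraph V) : Prop :=
  G.IsPlanar ∧ ∀ H : SimpleGraph V, G ≤ H → H.IsPlanar → H = G

open Set Metric Topology

/-- `(z - p) / (z - q)` has a continuous logarithm on `K`. -/
def HasLogRatio (K : Set ℂ) (p q : ℂ) : Prop :=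
  ∃ l : ℂ → ℂ, ContinuousOn l K ∧ ∀ z ∈ K, Complex.exp (l z) * (z - q) = z - p

theorem exists_continuous_exp_eq {X : Type*} [TopologicalSpace X] [SimplyConnectedSpace X]
    [LocallyPathConnectedSpace X] {g : X → ℂ} (hg : Continuous g) (h0 : ∀ x, g x ≠ 0) :
    ∃ h : X → ℂ, Continuous h ∧ ∀ x, Complex.exp (h x) = g x := by
  obtain ⟨x₀⟩ : Nonempty X := inferInstance
  obtain ⟨F, ⟨-, hF⟩, -⟩ := Complex.isCoveringMapOn_exp.existsUnique_continuousMap_lifts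
    ⟨g, hg⟩ (a₀ := x₀) (Complex.exp_log (h0 x₀)) h0
  exact ⟨F, F.continuous, fun x => congrFun hF x⟩

theorem not_continuous_ne_zero_of_eq_sub_off_bounded {g : ℂ → ℂ} (hg : Continuous g)
    (h0 : ∀ z, g z ≠ 0) (p : ℂ) {R : ℝ} (hR : 0 < R) (h : ∀ z ∈ sphere p R, g z = z - p) :
    False := by
  obtain ⟨l, hl, hexp⟩ := exists_continuous_exp_eq hg h0
  have hcirc : ∀ θ : ℝ, Complex.exp (l (circleMap p R θ)) = R * Complex.exp (θ * Complex.I) := by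
    intro θ
    rw [hexp, h _ (circleMap_mem_sphere p hR.le θ)]
    simp [circleMap]
  set k : ℝ → ℂ := fun θ => l (circleMap p R θ) - θ * Complex.I with hk
  have hkc : Continuous k := by
    have := continuous_circleMap p R
    fun_prop
  have hkexp : ∀ θ, Complex.exp (k θ) = R := by
    intro θ
    rw [hk]
    simp only [Complex.exp_sub, hcirc]
    field_simp [Complex.exp_ne_zero]
  have hconst : k (2 * Real.pi) = k 0 := by
    have hl : IsLocallyConstant k := by
      refine (IsLocallyConstant.iff_eventually_eq k).2 fun θ => ?_
      have h1 : ∀ᶠ y in 𝓝 θ, k y - k θ ∈ ball (0 : ℂ) 1 := by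
        have : Filter.Tendsto (fun y => k y - k θ) (𝓝 θ) (𝓝 (k θ - k θ)) :=
          (hkc.tendsto θ).sub_const _
        rw [sub_self] at this
        exact this (ball_mem_nhds _ one_pos)
      filter_upwards [h1] with y hy
      have he : Complex.exp (k y) = Complex.exp (k θ) := by rw [hkexp, hkexp]
      obtain ⟨n, hn⟩ := Complex.exp_eq_exp_iff_exists_int.1 he
      rw [hn, add_sub_cancel_left, mem_ball_zero_iff] at hy
      have : ‖(n : ℂ) * (2 * Real.pi * Complex.I)‖ = |(n : ℝ)| * (2 * Real.pi) := by
        simp [abs_of_pos Real.pi_pos]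
      rw [this] at hy
      have hn0 : n = 0 := by
        by_contra hne
        have : (1 : ℝ) ≤ |(n : ℝ)| := by exact_mod_cast Int.one_le_abs hne
        nlinarith [Real.pi_gt_three]
      rw [hn, hn0]; simp
    exact hl.apply_eq_of_isPreconnected isPreconnected_univ (mem_univ _) (mem_univ _)
  have : circleMap p R (2 * Real.pi) = circleMap p R 0 := by simp [circleMap]
  simp [hk, this, Real.pi_ne_zero] at hconst

theorem isPreconnected_norm_gt {R : ℝ} (hR : 0 < R) : IsPreconnected {z : ℂ | R < ‖z‖} := by
  have : {z : ℂ | R < ‖z‖} = Complex.exp '' {w : ℂ | Real.log R < w.re} := by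
    ext z
    constructor
    · intro hz
      have hz0 : z ≠ 0 := by
        rintro rfl
        simp at hz
        linarith
      refine ⟨Complex.log z, ?_, Complex.exp_log hz0⟩
      simpa [Complex.log_re] using Real.log_lt_log hR hz
    · rintro ⟨w, hw, rfl⟩
      simpa [Complex.norm_exp] using (Real.log_lt_iff_lt_exp hR).1 hw
  rw [this]
  exact ((convex_halfSpace_re_gt _).isPreconnected).image _ Complex.continuous_exp.continuousOn

theorem closure_component_inter_subset {X : Type*} [TopologicalSpace X] (O : Set X) (p : X) :
    closure (connectedComponentIn O p) ∩ O ⊆ connectedComponentIn O p := by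
  rintro z ⟨hz, hzO⟩
  by_cases hp : p ∈ O
  · have hpre : IsPreconnected (insert z (connectedComponentIn O p)) :=
      isPreconnected_connectedComponentIn.subset_closure (subset_insert _ _)
        (insert_subset hz subset_closure)
    exact hpre.subset_connectedComponentIn (mem_insert_of_mem _ (mem_connectedComponentIn hp))
      (insert_subset hzO (connectedComponentIn_subset _ _)) (mem_insert _ _)
  · simp [connectedComponentIn_eq_empty hp] at hz

theorem HasLogRatio.symm {K : Set ℂ} {p q : ℂ} (h : HasLogRatio K p q) : HasLogRatio K q p := by
  obtain ⟨l, hl, h⟩ := h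
  refine ⟨fun z => - l z, hl.neg, fun z hz => ?_⟩
  rw [← h z hz, ← mul_assoc, ← Complex.exp_add]
  simp

theorem HasLogRatio.trans {K : Set ℂ} {p q r : ℂ} (h : HasLogRatio K p q)
    (h' : HasLogRatio K q r) : HasLogRatio K p r := by
  obtain ⟨l, hl, h⟩ := h
  obtain ⟨l', hl', h'⟩ := h'
  refine ⟨fun z => l z + l' z, hl.add hl', fun z hz => ?_⟩
  rw [Complex.exp_add, mul_assoc, h' z hz, h z hz]

/-- Two points joined by a connected set off `K` have a logarithmic ratio on `K`. -/
theorem IsPreconnected.hasLogRatio {K S : Set ℂ} (hK : IsClosed K) (hS : IsPreconnected S)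
    (hSK : Disjoint S K) {p q : ℂ} (hp : p ∈ S) (hq : q ∈ S) : HasLogRatio K p q := by
  refine hS.induction₂ (HasLogRatio K) (fun x hx => ?_) (fun _ _ _ _ _ _ h h' => h.trans h')
    (fun _ _ _ _ h => h.symm) hp hq
  obtain ⟨ε, hε, hb⟩ := Metric.isOpen_iff.1 hK.isOpen_compl x (disjoint_left.1 hSK hx)
  refine mem_nhdsWithin_of_mem_nhds (Filter.mem_of_superset (ball_mem_nhds x hε) fun y hy => ?_)
  refine HasLogRatio.symm ?_
  have hne : ∀ z ∈ K, z - x ≠ 0 := fun z hz h0 =>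
    hb (mem_ball_self hε) (by rwa [← sub_eq_zero.1 h0])
  have hslit : ∀ z ∈ K, (z - y) / (z - x) ∈ Complex.slitPlane := by
    intro z hz
    have hzx : ε ≤ ‖z - x‖ := by
      by_contra! hlt
      exact hb (by simpa [dist_eq_norm] using hlt) hz
    have : (z - y) / (z - x) = 1 + (x - y) / (z - x) := by
      field_simp [hne z hz]
      ring
    rw [this]
    refine Complex.mem_slitPlane_of_norm_lt_one ?_
    rw [norm_div, div_lt_one (by linarith)]
    rw [mem_ball, dist_comm, dist_eq_norm] at hy
    linarith
  refine ⟨fun z => Complex.log ((z - y) / (z - x)), ?_, fun z hz => ?_⟩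
  · refine ContinuousOn.clog ?_ hslit
    exact ContinuousOn.div (by fun_prop) (by fun_prop) hne
  · rw [Complex.exp_log (Complex.slitPlane_ne_zero (hslit z hz)), div_mul_cancel₀ _ (hne z hz)]

theorem HasLogRatio.component_not_bounded {K : Set ℂ} (hK : IsClosed K) {p q : ℂ} (hp : p ∉ K)
    (h : HasLogRatio K p q) (hq : q ∉ connectedComponentIn Kᶜ p) {R : ℝ}
    (hb : connectedComponentIn Kᶜ p ⊆ closedBall 0 R) : False := by
  classical
  set U := connectedComponentIn Kᶜ p with hU
  have hUo : IsOpen U := hK.isOpen_compl.connectedComponentIn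
  have hpU : p ∈ U := mem_connectedComponentIn hp
  obtain ⟨l, hl, h⟩ := h
  obtain ⟨L, hL⟩ := ContinuousMap.exists_restrict_eq hK
    ⟨K.domRestrict l, continuousOn_iff_continuous_domRestrict.1 hl⟩
  have hLK : ∀ z ∈ K, L z = l z := fun z hz => congrArg (fun f => f ⟨z, hz⟩) hL
  have hfr : frontier U ⊆ K := by
    intro z hz
    by_contra hzK
    have := closure_component_inter_subset Kᶜ p ⟨hz.1, hzK⟩
    exact hz.2 (hUo.interior_eq.symm ▸ this)
  let g : ℂ → ℂ := U.piecewise (fun z => Complex.exp (L z) * (z - q)) (fun z => z - p)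
  have hg : Continuous g := by
    refine continuous_piecewise (fun z hz => ?_) (Continuous.continuousOn ?_)
      (Continuous.continuousOn ?_)
    · rw [hLK z (hfr hz), h z (hfr hz)]
    · have := L.continuous
      fun_prop
    · fun_prop
  have hg0 : ∀ z, g z ≠ 0 := by
    intro z
    by_cases hz : z ∈ U
    · simp only [g, piecewise_eq_of_mem _ _ _ hz]
      exact mul_ne_zero (Complex.exp_ne_zero _) (sub_ne_zero.2 fun e => hq (e ▸ hz))
    · simp only [g, piecewise_eq_of_notMem _ _ _ hz]
      exact sub_ne_zero.2 fun e => hz (e ▸ hpU)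
  refine not_continuous_ne_zero_of_eq_sub_off_bounded hg hg0 p
    (R := ‖p‖ + |R| + 1) (by positivity) fun z hz => ?_
  have hzU : z ∉ U := by
    intro hzU
    have h1 := hb hzU
    rw [mem_closedBall_zero_iff] at h1
    rw [mem_sphere, dist_eq_norm] at hz
    have := norm_sub_le z p
    have := le_abs_self R
    linarith
  simp only [g, piecewise_eq_of_notMem _ _ _ hzU]

/-- Eilenberg's criterion: a logarithmic ratio on `K` shows that `K` does not separate. -/
theorem HasLogRatio.mem_component {K : Set ℂ} (hK : IsCompact K) {p q : ℂ} (hp : p ∉ K)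
    (hq : q ∉ K) (h : HasLogRatio K p q) : q ∈ connectedComponentIn Kᶜ p := by
  by_contra hne
  have hne' : p ∉ connectedComponentIn Kᶜ q := by
    intro h'
    rw [← connectedComponentIn_eq h'] at hne
    exact hne (mem_connectedComponentIn hq)
  obtain ⟨R, hR, hKR⟩ := hK.isBounded.subset_closedBall_lt 0 0
  have hout : {z : ℂ | R < ‖z‖} ⊆ Kᶜ := fun z hz hzK => by
    have := hKR hzK
    rw [mem_closedBall_zero_iff] at this
    exact absurd hz (not_lt.2 this)
  have key : ∀ a b, a ∉ K → HasLogRatio K a b → b ∉ connectedComponentIn Kᶜ a →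
      ∃ z, R < ‖z‖ ∧ z ∈ connectedComponentIn Kᶜ a := by
    intro a b ha hab hb
    by_contra! hz
    exact hab.component_not_bounded hK.isClosed ha hb (R := R) fun z hzU => by
      rw [mem_closedBall_zero_iff]
      by_contra! hlt
      exact hz z hlt hzU
  obtain ⟨z, hz, hzp⟩ := key p q hp h hne
  obtain ⟨w, hw, hwq⟩ := key q p hq h.symm hne'
  have hwp : w ∈ connectedComponentIn Kᶜ p := by
    rw [connectedComponentIn_eq hzp]
    exact (isPreconnected_norm_gt hR).subset_connectedComponentIn hz hout hw
  rw [connectedComponentIn_eq hwp, ← connectedComponentIn_eq hwq] at hne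
  exact hne (mem_connectedComponentIn hq)

theorem HasLogRatio.union {K₁ K₂ : Set ℂ} (h₁ : IsClosed K₁) (h₂ : IsClosed K₂) {p q c : ℂ}
    (hc : K₁ ∩ K₂ = {c}) (hq : q ∉ K₁)
    (hl₁ : HasLogRatio K₁ p q) (hl₂ : HasLogRatio K₂ p q) : HasLogRatio (K₁ ∪ K₂) p q := by
  classical
  obtain ⟨l₁, hc₁, hl₁⟩ := hl₁
  obtain ⟨l₂, hc₂, hl₂⟩ := hl₂
  have hcm : c ∈ K₁ ∩ K₂ := hc ▸ mem_singleton c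
  have hcq : c - q ≠ 0 := sub_ne_zero.2 fun e => hq (e ▸ hcm.1)
  have hexp : Complex.exp (l₁ c) = Complex.exp (l₂ c) :=
    mul_right_cancel₀ hcq ((hl₁ c hcm.1).trans (hl₂ c hcm.2).symm)
  set l₂' : ℂ → ℂ := fun z => l₂ z + (l₁ c - l₂ c) with hl₂'
  have hl₂'e : ∀ z ∈ K₂, Complex.exp (l₂' z) * (z - q) = z - p := by
    intro z hz
    rw [hl₂', Complex.exp_add, Complex.exp_sub, hexp, div_self (Complex.exp_ne_zero _), mul_one,
      hl₂ z hz]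
  refine ⟨K₁.piecewise l₁ l₂', ?_, ?_⟩
  · have e₁ : EqOn (K₁.piecewise l₁ l₂') l₁ K₁ := fun z hz => piecewise_eq_of_mem _ _ _ hz
    have e₂ : EqOn (K₁.piecewise l₁ l₂') l₂' K₂ := by
      intro z hz
      by_cases hz1 : z ∈ K₁
      · have : z = c := by
          have : z ∈ K₁ ∩ K₂ := ⟨hz1, hz⟩
          rwa [hc] at this
        rw [piecewise_eq_of_mem _ _ _ hz1, this]
        simp [hl₂']
      · exact piecewise_eq_of_notMem _ _ _ hz1
    exact (hc₁.congr e₁).union_of_isClosed ((hc₂.add continuousOn_const).congr e₂) h₁ h₂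
  · rintro z hz
    by_cases hz1 : z ∈ K₁
    · rw [piecewise_eq_of_mem _ _ _ hz1, hl₁ z hz1]
    · rw [piecewise_eq_of_notMem _ _ _ hz1, hl₂'e z (hz.resolve_left hz1)]

/-- `A` is a simple arc from `x` to `y`. -/
def IsSimpleArc {X : Type*} [TopologicalSpace X] (A : Set X) (x y : X) : Prop :=
  ∃ f : ℝ → X, ContinuousOn f (Icc 0 1) ∧ InjOn f (Icc 0 1) ∧ f 0 = x ∧ f 1 = y ∧
    f '' Icc 0 1 = A

section arcs

variable {X Y : Type*} [TopologicalSpace X] [TopologicalSpace Y]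

theorem isSimpleArc_image_Icc {f : ℝ → X} {a b : ℝ} (hab : a < b) (hc : ContinuousOn f (Icc a b))
    (hi : InjOn f (Icc a b)) : IsSimpleArc (f '' Icc a b) (f a) (f b) := by
  have hba : 0 < b - a := sub_pos.2 hab
  have himg : (fun t => (b - a) * t + a) '' Icc (0 : ℝ) 1 = Icc a b := by
    rw [image_affine_Icc' hba]
    simp
  have hmap : MapsTo (fun t => (b - a) * t + a) (Icc (0 : ℝ) 1) (Icc a b) :=
    mapsTo_iff_image_subset.2 himg.subset
  refine ⟨f ∘ fun t => (b - a) * t + a, hc.comp (by fun_prop) hmap, hi.comp ?_ hmap, by simp,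
    by simp, ?_⟩
  · intro s _ t _ h
    have := mul_left_cancel₀ hba.ne' (add_right_cancel h)
    exact this
  · rw [image_comp, himg]

theorem IsSimpleArc.symm {A : Set X} {x y : X} (h : IsSimpleArc A x y) : IsSimpleArc A y x := by
  obtain ⟨f, hc, hi, rfl, rfl, rfl⟩ := h
  have himg : (fun t : ℝ => 1 - t) '' Icc (0 : ℝ) 1 = Icc 0 1 := by simp
  have hmap : MapsTo (fun t : ℝ => 1 - t) (Icc (0 : ℝ) 1) (Icc 0 1) :=
    mapsTo_iff_image_subset.2 himg.subset
  refine ⟨f ∘ fun t => 1 - t, hc.comp (by fun_prop) hmap, hi.comp ?_ hmap, by simp, by simp, ?_⟩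
  · intro s _ t _ h
    simpa using h
  · rw [image_comp, himg]

theorem IsSimpleArc.image {A : Set X} {x y : X} (h : IsSimpleArc A x y) {φ : X → Y}
    (hc : ContinuousOn φ A) (hi : InjOn φ A) : IsSimpleArc (φ '' A) (φ x) (φ y) := by
  obtain ⟨f, hfc, hfi, rfl, rfl, rfl⟩ := h
  exact ⟨φ ∘ f, hc.comp hfc (mapsTo_image _ _), hi.comp hfi (mapsTo_image _ _), rfl, rfl,
    image_comp _ _ _⟩

theorem IsSimpleArc.isCompact {A : Set X} {x y : X} (h : IsSimpleArc A x y) : IsCompact A := by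
  obtain ⟨f, hc, -, -, -, rfl⟩ := h
  exact isCompact_Icc.image_of_continuousOn hc

theorem IsSimpleArc.left_mem {A : Set X} {x y : X} (h : IsSimpleArc A x y) : x ∈ A := by
  obtain ⟨f, -, -, rfl, -, rfl⟩ := h
  exact mem_image_of_mem _ (by simp)

theorem IsSimpleArc.right_mem {A : Set X} {x y : X} (h : IsSimpleArc A x y) : y ∈ A :=
  h.symm.left_mem

theorem IsSimpleArc.union {A B : Set X} {x y z : X} (hA : IsSimpleArc A x y)
    (hB : IsSimpleArc B y z) (hAB : A ∩ B ⊆ {y}) : IsSimpleArc (A ∪ B) x z := by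
  obtain ⟨f, hfc, hfi, rfl, rfl, rfl⟩ := hA
  obtain ⟨g, hgc, hgi, hg0, rfl, rfl⟩ := hB
  set h : ℝ → X := fun t => if t ≤ 1 then f t else g (t - 1) with hh
  have ef : EqOn h f (Icc 0 1) := fun t ht => by simp [hh, ht.2]
  have eg : EqOn h (fun t => g (t - 1)) (Icc 1 2) := fun t ht => by
    by_cases h1 : t ≤ 1
    · have : t = 1 := le_antisymm h1 ht.1
      subst this
      simp [hh, hg0]
    · simp [hh, h1]
  have hsh : (fun t : ℝ => t - 1) '' Icc 1 2 = Icc 0 1 := by norm_num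
  have hmap : MapsTo (fun t : ℝ => t - 1) (Icc 1 2) (Icc 0 1) :=
    mapsTo_iff_image_subset.2 hsh.subset
  have hu : Icc (0 : ℝ) 1 ∪ Icc 1 2 = Icc 0 2 := Icc_union_Icc_eq_Icc (by norm_num) (by norm_num)
  have hhc : ContinuousOn h (Icc 0 2) := by
    rw [← hu]
    exact (hfc.congr ef).union_of_isClosed ((hgc.comp (by fun_prop) hmap).congr eg) isClosed_Icc
      isClosed_Icc
  have hcross : ∀ s ∈ Icc (0 : ℝ) 1, ∀ t ∈ Icc (1 : ℝ) 2, h s = h t → s = t := by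
    intro s hs t ht hst
    rw [ef hs, eg ht] at hst
    have hm : f s ∈ f '' Icc 0 1 ∩ g '' Icc 0 1 :=
      ⟨mem_image_of_mem _ hs, hst ▸ mem_image_of_mem _ (hmap ht)⟩
    have h1 : f s = f 1 := hAB hm
    have h2 : g (t - 1) = g 0 := hst.symm.trans (h1.trans hg0.symm)
    have h3 := hfi hs (by simp) h1
    have h4 := hgi (hmap ht) (by simp) h2
    linarith
  have hhi : InjOn h (Icc 0 2) := by
    rw [← hu]
    rintro s (hs | hs) t (ht | ht) hst
    · rw [ef hs, ef ht] at hst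
      exact hfi hs ht hst
    · exact hcross s hs t ht hst
    · exact (hcross t ht s hs hst.symm).symm
    · rw [eg hs, eg ht] at hst
      have := hgi (hmap hs) (hmap ht) hst
      linarith
  have := isSimpleArc_image_Icc (by norm_num) hhc hhi
  rw [← hu, image_union, ef.image_eq, eg.image_eq, ← image_image g (fun t => t - 1), hsh,
    ef (by simp), eg (by simp)] at this
  norm_num at this
  exact this

theorem isSimpleArc_segment {p q : ℂ} (hpq : p ≠ q) : IsSimpleArc (segment ℝ p q) p q := by
  refine ⟨AffineMap.lineMap p q, (AffineMap.lineMap_continuous).continuousOn,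
    (AffineMap.lineMap_injective ℝ hpq).injOn, by simp, by simp, ?_⟩
  exact (segment_eq_image_lineMap ℝ p q).symm

/-- `x` and `y` agree or are joined by a simple arc inside `S`. -/
def ArcJoined (S : Set X) (x y : X) : Prop := x = y ∨ ∃ A ⊆ S, IsSimpleArc A x y

theorem ArcJoined.symm {S : Set X} {x y : X} (h : ArcJoined S x y) : ArcJoined S y x := by
  rcases h with rfl | ⟨A, hA, h⟩
  · exact Or.inl rfl
  · exact Or.inr ⟨A, hA, h.symm⟩

theorem ArcJoined.mono {S T : Set X} {x y : X} (hST : S ⊆ T) (h : ArcJoined S x y) :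
    ArcJoined T x y :=
  h.imp_right fun ⟨A, hA, h⟩ => ⟨A, hA.trans hST, h⟩

theorem arcJoined_image_Icc {f : ℝ → X} {a b : ℝ} (hab : a ≤ b) (hc : ContinuousOn f (Icc a b))
    (hi : InjOn f (Icc a b)) : ArcJoined (f '' Icc a b) (f a) (f b) := by
  rcases hab.eq_or_lt with rfl | hlt
  · exact Or.inl rfl
  · exact Or.inr ⟨_, Subset.rfl, isSimpleArc_image_Icc hlt hc hi⟩

theorem ArcJoined.trans [T2Space X] {S : Set X} {x y z : X} (h : ArcJoined S x y)
    (h' : ArcJoined S y z) : ArcJoined S x z := by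
  rcases h with rfl | ⟨A, hA, f, hfc, hfi, rfl, rfl, rfl⟩
  · exact h'
  rcases h' with rfl | ⟨B, hB, hBarc⟩
  · exact Or.inr ⟨_, hA, f, hfc, hfi, rfl, rfl, rfl⟩
  have hBcl : IsClosed B := hBarc.isCompact.isClosed
  have hTc : IsCompact (Icc (0 : ℝ) 1 ∩ f ⁻¹' B) :=
    isCompact_Icc.of_isClosed_subset (hfc.preimage_isClosed_of_isClosed isClosed_Icc hBcl)
      inter_subset_left
  obtain ⟨t, ⟨⟨ht0, ht1⟩, htB⟩, htmin⟩ := hTc.exists_isLeast ⟨1, by simp, hBarc.left_mem⟩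
  obtain ⟨g, hgc, hgi, hg0, rfl, rfl⟩ := hBarc
  obtain ⟨u, ⟨hu0, hu1⟩, hu⟩ := htB
  have hsubt : Icc 0 t ⊆ Icc (0 : ℝ) 1 := Icc_subset_Icc_right ht1
  have hsubu : Icc u 1 ⊆ Icc (0 : ℝ) 1 := Icc_subset_Icc_left hu0
  have h1 : ArcJoined S (f 0) (f t) :=
    (arcJoined_image_Icc ht0 (hfc.mono hsubt) (hfi.mono hsubt)).mono
      ((image_mono hsubt).trans hA)
  have h2 : ArcJoined S (f t) (g 1) := by
    rw [← hu]
    exact (arcJoined_image_Icc hu1 (hgc.mono hsubu) (hgi.mono hsubu)).mono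
      ((image_mono hsubu).trans hB)
  rcases ht0.eq_or_lt with rfl | ht0
  · exact h2
  rcases hu1.eq_or_lt with rfl | hu1
  · rwa [hu]
  refine Or.inr ⟨_, union_subset ((image_mono hsubt).trans hA) ((image_mono hsubu).trans hB),
    (isSimpleArc_image_Icc ht0 (hfc.mono hsubt) (hfi.mono hsubt)).union
      (hu ▸ isSimpleArc_image_Icc hu1 (hgc.mono hsubu) (hgi.mono hsubu)) ?_⟩
  rintro _ ⟨⟨s, hs, rfl⟩, v, hv, hvs⟩
  have : t ≤ s := htmin ⟨hsubt hs, v, hsubu hv, hvs⟩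
  rw [mem_singleton_iff, le_antisymm hs.2 this]

theorem arcJoined_of_segment_subset {S : Set ℂ} {p q : ℂ} (h : segment ℝ p q ⊆ S) :
    ArcJoined S p q := by
  by_cases hpq : p = q
  · exact Or.inl hpq
  · exact Or.inr ⟨_, h, isSimpleArc_segment hpq⟩

theorem IsPreconnected.arcJoined {U : Set ℂ} (hU : IsPreconnected U) (hUo : IsOpen U) {p q : ℂ}
    (hp : p ∈ U) (hq : q ∈ U) : ArcJoined U p q := by
  refine hU.induction₂ (ArcJoined U) (fun x hx => ?_) (fun _ _ _ _ _ _ h h' => h.trans h')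
    (fun _ _ _ _ h => h.symm) hp hq
  obtain ⟨ε, hε, hb⟩ := Metric.isOpen_iff.1 hUo x hx
  refine mem_nhdsWithin_of_mem_nhds (Filter.mem_of_superset (ball_mem_nhds x hε) fun y hy => ?_)
  exact arcJoined_of_segment_subset
    (((convex_ball x ε).segment_subset (mem_ball_self hε) hy).trans hb)

/-- The parameter of a simple arc is a continuous function of the point. -/
theorem exists_continuousOn_leftInvOn [T2Space X] {f : ℝ → X} {a b : ℝ}
    (hc : ContinuousOn f (Icc a b)) (hi : InjOn f (Icc a b)) :
    ∃ g : X → ℝ, ContinuousOn g (f '' Icc a b) ∧ ∀ t ∈ Icc a b, g (f t) = t := by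
  classical
  refine ⟨Function.invFunOn f (Icc a b), ?_, fun t ht => hi.leftInvOn_invFunOn ht⟩
  rw [continuousOn_iff_isClosed]
  intro C hC
  refine ⟨f '' (Icc a b ∩ C), ?_, ?_⟩
  · exact ((isCompact_Icc.inter_right hC).image_of_continuousOn
      (hc.mono inter_subset_left)).isClosed
  · ext z
    constructor
    · rintro ⟨hz, t, ht, rfl⟩
      refine ⟨⟨t, ⟨ht, ?_⟩, rfl⟩, t, ht, rfl⟩
      rwa [mem_preimage, hi.leftInvOn_invFunOn ht] at hz
    · rintro ⟨⟨t, ⟨ht, htC⟩, rfl⟩, -⟩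
      refine ⟨?_, t, ht, rfl⟩
      rwa [mem_preimage, hi.leftInvOn_invFunOn ht]

end arcs

theorem hasLogRatio_image_Icc {f : ℝ → ℂ} {a b : ℝ} (hab : a ≤ b) (hc : ContinuousOn f (Icc a b))
    (hi : InjOn f (Icc a b)) {p q : ℂ} (hp : p ∉ f '' Icc a b) (hq : q ∉ f '' Icc a b) :
    HasLogRatio (f '' Icc a b) p q := by
  obtain ⟨g, hg, hgf⟩ := exists_continuousOn_leftInvOn hc hi
  have hF : Continuous (IccExtend hab ((Icc a b).domRestrict f)) :=
    (continuousOn_iff_continuous_domRestrict.1 hc).Icc_extend'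
  have hFmem : ∀ t, IccExtend hab ((Icc a b).domRestrict f) t ∈ f '' Icc a b := fun t =>
    ⟨_, (projIcc a b hab t).2, rfl⟩
  have hne : ∀ t, ∀ r ∉ f '' Icc a b, IccExtend hab ((Icc a b).domRestrict f) t - r ≠ 0 :=
    fun t r hr h0 => hr (sub_eq_zero.1 h0 ▸ hFmem t)
  obtain ⟨h, hh, hexp⟩ := exists_continuous_exp_eq
    (g := fun t => (IccExtend hab ((Icc a b).domRestrict f) t - p) /
      (IccExtend hab ((Icc a b).domRestrict f) t - q))
    (Continuous.div (by fun_prop) (by fun_prop) fun t => hne t q hq)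
    (fun t => div_ne_zero (hne t p hp) (hne t q hq))
  refine ⟨h ∘ g, hh.comp_continuousOn hg, ?_⟩
  rintro _ ⟨t, ht, rfl⟩
  have e : IccExtend hab ((Icc a b).domRestrict f) t = f t := by
    rw [IccExtend_of_mem _ _ ht]; rfl
  have hq' := hne t q hq
  rw [e] at hq'
  rw [Function.comp_apply, hgf t ht, hexp, e, div_mul_cancel₀ _ hq']

/-- A component of the complement whose closure meets the interior of an arc, the arc being
attached to the rest of the removed set at its ends only, has the end of the arc in its closure. -/
theorem arc_end_mem_closure_component {K : Set ℂ} (hK : IsCompact K) {f : ℝ → ℂ}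
    (hc : ContinuousOn f (Icc 0 1)) (hi : InjOn f (Icc 0 1)) (h0 : f 0 ∈ K)
    (hfK : ∀ t ∈ Ioo (0 : ℝ) 1, f t ∉ K) {z₀ : ℂ} {s : ℝ} (hs : s ∈ Ioo (0 : ℝ) 1)
    (hsF : f s ∈ closure (connectedComponentIn (K ∪ f '' Icc 0 1)ᶜ z₀)) :
    f 1 ∈ closure (connectedComponentIn (K ∪ f '' Icc 0 1)ᶜ z₀) := by
  set X := K ∪ f '' Icc 0 1 with hX
  set F := connectedComponentIn Xᶜ z₀ with hF
  have hXc : IsCompact X := hK.union (isCompact_Icc.image_of_continuousOn hc)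
  have hFX : F ⊆ Xᶜ := connectedComponentIn_subset _ _
  have hFo : IsOpen F := hXc.isClosed.isOpen_compl.connectedComponentIn
  have hsub : Icc s 1 ⊆ Icc (0 : ℝ) 1 := Icc_subset_Icc_left hs.1.le
  have hTc : IsCompact (Icc s 1 ∩ f ⁻¹' closure F) :=
    isCompact_Icc.of_isClosed_subset
      ((hc.mono hsub).preimage_isClosed_of_isClosed isClosed_Icc isClosed_closure)
      inter_subset_left
  obtain ⟨t, ⟨⟨hst, ht1⟩, htF⟩, htmax⟩ := hTc.exists_isGreatest ⟨s, ⟨le_rfl, hs.2.le⟩, hsF⟩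
  rcases ht1.eq_or_lt with rfl | ht1
  · exact htF
  exfalso
  have ht0 : 0 < t := hs.1.trans_le hst
  obtain ⟨ε, hε, hb⟩ := Metric.isOpen_iff.1 hK.isClosed.isOpen_compl (f t) (hfK t ⟨ht0, ht1⟩)
  obtain ⟨p, hpb, hpF⟩ := mem_closure_iff.1 htF _ isOpen_ball (mem_ball_self hε)
  obtain ⟨u, ⟨htu, hu1⟩, hub⟩ : ∃ u ∈ Ioo t 1, f u ∈ ball (f t) ε := by
    have hct : ContinuousWithinAt f (Ioo t 1) t :=
      (hc t ⟨ht0.le, ht1.le⟩).mono fun u hu => ⟨ht0.le.trans hu.1.le, hu.2.le⟩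
    have hne : (𝓝[Ioo t 1] t).NeBot := by
      rw [nhdsWithin_Ioo_eq_nhdsGT ht1]
      infer_instance
    have := (hct.eventually (ball_mem_nhds (f t) hε)).and self_mem_nhdsWithin
    obtain ⟨u, hu, hu'⟩ := this.exists
    exact ⟨u, hu', hu⟩
  have hsubt : Icc 0 t ⊆ Icc (0 : ℝ) 1 := Icc_subset_Icc_right ht1.le
  have huI : u ∈ Icc (0 : ℝ) 1 := ⟨(ht0.trans htu).le, hu1.le⟩
  have hpK : p ∉ K := fun h => hFX hpF (Or.inl h)
  have hqK : f u ∉ K := hfK u ⟨ht0.trans htu, hu1⟩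
  have hp2 : p ∉ f '' Icc 0 t := fun h => hFX hpF (Or.inr (image_mono hsubt h))
  have hq2 : f u ∉ f '' Icc 0 t := by
    rintro ⟨v, hv, hvu⟩
    have := hi (hsubt hv) huI hvu
    linarith [hv.2]
  have hlog₁ : HasLogRatio K p (f u) := by
    have hpre : IsPreconnected (F ∪ ball (f t) ε) :=
      isPreconnected_connectedComponentIn.union p hpF hpb isPreconnected_ball
    refine hpre.hasLogRatio hK.isClosed ?_ (Or.inl hpF) (Or.inr hub)
    rw [disjoint_left]
    rintro z (hz | hz) hzK
    · exact hFX hz (Or.inl hzK)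
    · exact hb hz hzK
  have hlog₂ : HasLogRatio (f '' Icc 0 t) p (f u) :=
    hasLogRatio_image_Icc ht0.le (hc.mono hsubt) (hi.mono hsubt) hp2 hq2
  have hcap : K ∩ f '' Icc 0 t = {f 0} := by
    apply Subset.antisymm
    · rintro _ ⟨hzK, v, hv, rfl⟩
      rcases hv.1.eq_or_lt with rfl | hv0
      · rfl
      · exact absurd hzK (hfK v ⟨hv0, hv.2.trans_lt ht1⟩)
    · rintro _ rfl
      exact ⟨h0, 0, ⟨le_rfl, ht0.le⟩, rfl⟩
  have hK2 : IsCompact (f '' Icc 0 t) := isCompact_Icc.image_of_continuousOn (hc.mono hsubt)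
  have hmem : f u ∈ connectedComponentIn (K ∪ f '' Icc 0 t)ᶜ p :=
    (hlog₁.union hK.isClosed hK2.isClosed hcap hqK hlog₂).mem_component (hK.union hK2)
      (by simp only [mem_union, not_or]; exact ⟨hpK, hp2⟩)
      (by simp only [mem_union, not_or]; exact ⟨hqK, hq2⟩)
  have hpc : p ∈ connectedComponentIn (K ∪ f '' Icc 0 t)ᶜ p :=
    mem_connectedComponentIn (by simp only [mem_compl_iff, mem_union, not_or]; exact ⟨hpK, hp2⟩)
  have hsubF : connectedComponentIn (K ∪ f '' Icc 0 t)ᶜ p ⊆ F := by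
    refine isPreconnected_connectedComponentIn.subset_of_closure_inter_subset hFo ⟨p, hpc, hpF⟩ ?_
    rintro z ⟨hzF, hz⟩
    refine closure_component_inter_subset Xᶜ z₀ ⟨hzF, ?_⟩
    have hz' := connectedComponentIn_subset _ _ hz
    rintro (hzK | ⟨v, hv, rfl⟩)
    · exact hz' (Or.inl hzK)
    · have hvt : t < v := by
        by_contra! hle
        exact hz' (Or.inr ⟨v, ⟨hv.1, hle⟩, rfl⟩)
      exact absurd (htmax ⟨⟨hst.trans hvt.le, hv.2⟩, hzF⟩) (not_le.2 hvt)
  exact hFX (hsubF hmem) (Or.inr ⟨u, huI, rfl⟩)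

/-- A plane drawing of `G` in `ℂ`. -/
structure PlaneDrawing {V : Type*} (G : SimpleGraph V) where
  pos : V → ℂ
  arc : Sym2 V → Set ℂ
  pos_inj : Function.Injective pos
  arc_isArc : ∀ e ∈ G.edgeSet, ∀ v w : V, e = s(v, w) → IsSimpleArc (arc e) (pos v) (pos w)
  arc_vertex : ∀ e ∈ G.edgeSet, ∀ v : V, pos v ∈ arc e → v ∈ e
  arc_inter : ∀ e ∈ G.edgeSet, ∀ e' ∈ G.edgeSet, e ≠ e' →
    arc e ∩ arc e' ⊆ {x | ∃ v : V, v ∈ e ∧ v ∈ e' ∧ pos v = x}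

namespace PlaneDrawing

variable {V : Type*} {G : SimpleGraph V} (D : PlaneDrawing G)

/-- The point set of a plane drawing. -/
def image : Set ℂ := range D.pos ∪ ⋃ e ∈ G.edgeSet, D.arc e

theorem pos_mem_image (v : V) : D.pos v ∈ D.image := Or.inl (mem_range_self v)

variable {D} in
theorem arc_subset_image {e : Sym2 V} (he : e ∈ G.edgeSet) : D.arc e ⊆ D.image :=
  (subset_biUnion_of_mem (u := fun e => D.arc e) he).trans subset_union_right

theorem isCompact_arc {e : Sym2 V} (he : e ∈ G.edgeSet) : IsCompact (D.arc e) := by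
  induction e with
  | h v w => exact (D.arc_isArc _ he v w rfl).isCompact

theorem isCompact_image [Finite V] : IsCompact D.image :=
  (finite_range D.pos).isCompact.union
    ((toFinite G.edgeSet).isCompact_biUnion fun _ he => D.isCompact_arc he)

theorem end_mem_closure_component [Finite V] {v w : V} (h : G.Adj v w) {p z₀ : ℂ}
    (hp : p ∈ D.arc s(v, w)) (hv : p ≠ D.pos v)
    (hpF : p ∈ closure (connectedComponentIn D.imageᶜ z₀)) :
    D.pos w ∈ closure (connectedComponentIn D.imageᶜ z₀) := by
  obtain ⟨f, hc, hi, hf0, hf1, hfA⟩ := D.arc_isArc s(v, w) h v w rfl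
  set K : Set ℂ := range D.pos ∪ ⋃ e ∈ G.edgeSet \ {s(v, w)}, D.arc e with hK
  have hKc : IsCompact K := (finite_range D.pos).isCompact.union
    ((toFinite (G.edgeSet \ {s(v, w)})).isCompact_biUnion fun _ he => D.isCompact_arc he.1)
  have himg : D.image = K ∪ f '' Icc 0 1 := by
    have hs : s(v, w) ∈ G.edgeSet := h
    rw [hfA, hK, union_assoc, image]
    congr 1
    conv_lhs => rw [← sdiff_union_of_subset (singleton_subset_iff.2 hs), biUnion_union]
    simp
  rw [← hfA] at hp
  obtain ⟨t, ht, rfl⟩ := hp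
  rcases ht.2.eq_or_lt with rfl | ht1
  · rwa [hf1] at hpF
  have ht0 : 0 < t := ht.1.lt_of_ne (by rintro rfl; exact hv hf0)
  rw [himg] at hpF ⊢
  rw [← hf1]
  refine arc_end_mem_closure_component hKc hc hi (by rw [hf0]; exact Or.inl (mem_range_self v)) ?_
    ⟨ht0, ht1⟩ hpF
  intro u hu huK
  have huI : u ∈ Icc (0 : ℝ) 1 := ⟨hu.1.le, hu.2.le⟩
  have huA : f u ∈ D.arc s(v, w) := hfA ▸ mem_image_of_mem f huI
  obtain ⟨x, hx⟩ : ∃ x : V, D.pos x = f u := by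
    rcases huK with ⟨x, hx⟩ | huK
    · exact ⟨x, hx⟩
    · simp only [mem_iUnion] at huK
      obtain ⟨e, ⟨he, hne⟩, hue⟩ := huK
      obtain ⟨x, -, -, hx⟩ := D.arc_inter e he _ h hne ⟨hue, huA⟩
      exact ⟨x, hx⟩
  have := D.arc_vertex _ h x (hx ▸ huA)
  rcases Sym2.mem_iff.1 this with rfl | rfl
  · exact hu.1.ne (hi (by simp) huI (hf0.trans hx))
  · exact hu.2.ne' (hi (by simp) huI (hf1.trans hx))

end PlaneDrawing

theorem IsSimpleArc.exists_exit {A : Set ℂ} {x y : ℂ} (h : IsSimpleArc A x y) {r : ℝ} (hr : 0 < r)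
    (hy : y ∉ closedBall x r) :
    ∃ p ∈ sphere x r, ∃ C ⊆ A, IsSimpleArc C p y ∧ C ∩ closedBall x r = {p} := by
  obtain ⟨f, hc, hi, rfl, rfl, rfl⟩ := h
  have hTc : IsCompact (Icc (0 : ℝ) 1 ∩ f ⁻¹' closedBall (f 0) r) :=
    isCompact_Icc.of_isClosed_subset (hc.preimage_isClosed_of_isClosed isClosed_Icc
      isClosed_closedBall) inter_subset_left
  obtain ⟨t, ⟨ht, htB⟩, htmax⟩ := hTc.exists_isGreatest ⟨0, by simp, by simp [hr.le]⟩
  have ht1 : t < 1 := ht.2.lt_of_ne (by rintro rfl; exact hy htB)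
  have hsub : Icc t 1 ⊆ Icc (0 : ℝ) 1 := Icc_subset_Icc_left ht.1
  refine ⟨f t, ?_, f '' Icc t 1, image_mono hsub,
    isSimpleArc_image_Icc ht1 (hc.mono hsub) (hi.mono hsub), ?_⟩
  · refine le_antisymm htB ?_
    by_contra! hlt
    have hct : ContinuousWithinAt f (Ioo t 1) t :=
      (hc t ht).mono fun u hu => ⟨ht.1.trans hu.1.le, hu.2.le⟩
    have hne : (𝓝[Ioo t 1] t).NeBot := by
      rw [nhdsWithin_Ioo_eq_nhdsGT ht1]
      infer_instance
    obtain ⟨u, hu, hu'⟩ := ((hct.eventually (isOpen_ball.mem_nhds (mem_ball.2 hlt))).and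
      self_mem_nhdsWithin).exists
    exact absurd (htmax ⟨⟨ht.1.trans hu'.1.le, hu'.2.le⟩, ball_subset_closedBall hu⟩)
      (not_le.2 hu'.1)
  · apply Subset.antisymm
    · rintro _ ⟨⟨u, hu, rfl⟩, hub⟩
      rw [mem_singleton_iff, le_antisymm (htmax ⟨hsub hu, hub⟩) hu.1]
    · rintro _ rfl
      exact ⟨⟨t, ⟨le_rfl, ht1.le⟩, rfl⟩, htB⟩

theorem IsSimpleArc.exists_straightened {A : Set ℂ} {x y : ℂ} (h : IsSimpleArc A x y) {r : ℝ}
    (hr : 0 < r) (hd : Disjoint (closedBall x r) (closedBall y r)) :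
    ∃ B, IsSimpleArc B x y ∧ B ⊆ A ∪ closedBall x r ∪ closedBall y r ∧
      (∃ p ∈ sphere x r ∩ A, B ∩ closedBall x r = segment ℝ x p) ∧
      ∃ q ∈ sphere y r ∩ A, B ∩ closedBall y r = segment ℝ y q := by
  obtain ⟨p, hp, C, hCA, hC, hCx⟩ :=
    h.exists_exit hr (disjoint_right.1 hd (mem_closedBall_self hr.le))
  have hpx : p ∈ closedBall x r := sphere_subset_closedBall hp
  obtain ⟨q, hq, E, hEC, hE, hEy⟩ := hC.symm.exists_exit hr (disjoint_left.1 hd hpx)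
  have hqy : q ∈ closedBall y r := sphere_subset_closedBall hq
  have hsx : segment ℝ x p ⊆ closedBall x r :=
    (convex_closedBall x r).segment_subset (mem_closedBall_self hr.le) hpx
  have hsy : segment ℝ y q ⊆ closedBall y r :=
    (convex_closedBall y r).segment_subset (mem_closedBall_self hr.le) hqy
  have hxp : x ≠ p := by
    rintro rfl
    simp [hr.ne] at hp
  have hyq : y ≠ q := by
    rintro rfl
    simp [hr.ne] at hq
  have hEx : E ∩ closedBall x r = {p} :=
    Subset.antisymm ((inter_subset_inter_left _ hEC).trans hCx.subset)
      (singleton_subset_iff.2 ⟨hE.right_mem, hpx⟩)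
  have h1 : IsSimpleArc (E ∪ segment ℝ y q) p y :=
    hE.symm.union (segment_symm ℝ y q ▸ isSimpleArc_segment hyq.symm)
      ((inter_subset_inter_right _ hsy).trans hEy.subset)
  have h2 : IsSimpleArc (segment ℝ x p ∪ (E ∪ segment ℝ y q)) x y := by
    refine (isSimpleArc_segment hxp).union h1 ?_
    rintro z ⟨hz, hz' | hz'⟩
    · exact hEx.subset ⟨hz', hsx hz⟩
    · exact absurd (hsy hz') (disjoint_left.1 hd (hsx hz))
  refine ⟨_, h2, ?_, ⟨p, ⟨hp, hCA hC.left_mem⟩, ?_⟩, q, ⟨hq, hCA (hEC hE.left_mem)⟩, ?_⟩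
  · rintro z (hz | hz | hz)
    · exact Or.inl (Or.inr (hsx hz))
    · exact Or.inl (Or.inl (hCA (hEC hz)))
    · exact Or.inr (hsy hz)
  · apply Subset.antisymm
    · rintro z ⟨hz | hz | hz, hzx⟩
      · exact hz
      · rw [mem_singleton_iff.1 (hEx.subset ⟨hz, hzx⟩)]
        exact right_mem_segment ℝ x p
      · exact absurd (hsy hz) (disjoint_left.1 hd hzx)
    · exact fun z hz => ⟨Or.inl hz, hsx hz⟩
  · apply Subset.antisymm
    · rintro z ⟨hz | hz | hz, hzy⟩
      · exact absurd hzy (disjoint_left.1 hd (hsx hz))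
      · rw [mem_singleton_iff.1 (hEy.subset ⟨hz, hzy⟩)]
        exact right_mem_segment ℝ y q
      · exact hz
    · exact fun z hz => ⟨Or.inr (Or.inr hz), hsy hz⟩

/-- Points of a segment from the centre to the circle, in terms of their direction. -/
theorem mem_segment_of_smul_mem {x p z : ℂ} {r s : ℝ} (hp : p ∈ sphere x r) (hr : 0 < r)
    (hz : z ∈ closedBall x r) (hs : 0 < s) (h : x + s • (z - x) ∈ segment ℝ x p) :
    z ∈ segment ℝ x p := by
  rw [segment_eq_image'] at h ⊢
  obtain ⟨c, hc, hcz⟩ := h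
  have hcz : c • (p - x) = s • (z - x) := add_left_cancel hcz
  have hzx : z - x = (c / s) • (p - x) := by
    rw [div_eq_inv_mul, mul_smul, hcz, smul_smul, inv_mul_cancel₀ hs.ne', one_smul]
  have hcs : 0 ≤ c / s := div_nonneg hc.1 hs.le
  refine ⟨c / s, ⟨hcs, ?_⟩, by simp only [← hzx]; ring⟩
  rw [mem_closedBall, dist_eq_norm, hzx, norm_smul, ← dist_eq_norm, mem_sphere.1 hp,
    Real.norm_of_nonneg hcs] at hz
  exact le_of_mul_le_mul_right (by linarith) hr

theorem segment_inter_segment_of_sphere {x p q : ℂ} {r : ℝ} (hr : 0 < r) (hp : p ∈ sphere x r)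
    (hq : q ∈ sphere x r) (hpq : p ≠ q) : segment ℝ x p ∩ segment ℝ x q ⊆ {x} := by
  rintro z ⟨hzp, hzq⟩
  by_contra hzx
  rw [segment_eq_image'] at hzp hzq
  obtain ⟨c, hc, rfl⟩ := hzp
  obtain ⟨d, hd, hcd⟩ := hzq
  have hcd : d • (q - x) = c • (p - x) := add_left_cancel hcd
  have hn := congrArg norm hcd
  rw [norm_smul, norm_smul, ← dist_eq_norm, ← dist_eq_norm, mem_sphere.1 hp, mem_sphere.1 hq,
    Real.norm_of_nonneg hc.1, Real.norm_of_nonneg hd.1] at hn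
  have hdc : d = c := mul_right_cancel₀ hr.ne' hn
  subst hdc
  have hd0 : d ≠ 0 := by
    rintro rfl
    simp at hzx
  exact hpq (sub_left_injective (smul_right_injective ℂ hd0 hcd).symm)

namespace PlaneDrawing

variable {V : Type*} {G : SimpleGraph V}

/-- Around every vertex the drawing consists of radii of a disc of radius `r`. -/
structure IsStar (D : PlaneDrawing G) (r : ℝ) : Prop where
  pos : 0 < r
  vertex : ∀ v w, v ≠ w → D.pos w ∉ closedBall (D.pos v) r
  disjoint : ∀ v, ∀ e ∈ G.edgeSet, v ∉ e → Disjoint (D.arc e) (closedBall (D.pos v) r)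
  radius : ∀ v, ∀ e ∈ G.edgeSet, v ∈ e →
    ∃ p ∈ sphere (D.pos v) r, D.arc e ∩ closedBall (D.pos v) r = segment ℝ (D.pos v) p

theorem exists_radius [Finite V] (D : PlaneDrawing G) : ∃ r : ℝ, 0 < r ∧
    (∀ v w, v ≠ w → Disjoint (closedBall (D.pos v) r) (closedBall (D.pos w) r)) ∧
    ∀ v, ∀ e ∈ G.edgeSet, v ∉ e → Disjoint (D.arc e) (closedBall (D.pos v) r) := by
  have key : ∀ v, ∃ ε > 0, ball (D.pos v) ε ⊆
      (D.pos '' {v}ᶜ ∪ ⋃ e ∈ {e ∈ G.edgeSet | v ∉ e}, D.arc e)ᶜ := by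
    intro v
    have hc : IsCompact (D.pos '' {v}ᶜ ∪ ⋃ e ∈ {e ∈ G.edgeSet | v ∉ e}, D.arc e) :=
      (toFinite _).isCompact.union ((toFinite _).isCompact_biUnion
        fun _ he => D.isCompact_arc he.1)
    refine Metric.isOpen_iff.1 hc.isClosed.isOpen_compl _ ?_
    rintro (⟨w, hw, hwv⟩ | h)
    · exact hw (D.pos_inj hwv)
    · simp only [mem_iUnion] at h
      obtain ⟨e, ⟨he, hve⟩, h⟩ := h
      exact hve (D.arc_vertex e he v h)
  choose ε hε hb using key
  have hev : ∀ᶠ r in 𝓝[>] (0 : ℝ), ∀ v, r ∈ Ioo 0 (ε v / 2) :=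
    Filter.eventually_all.2 fun v => Ioo_mem_nhdsGT (half_pos (hε v))
  obtain ⟨r, hr, hr0⟩ := (hev.and self_mem_nhdsWithin).exists
  refine ⟨r, hr0, fun v w hvw => ?_, fun v e he hve => ?_⟩
  · rw [disjoint_left]
    intro z hzv hzw
    refine hb v ?_ (Or.inl ⟨w, hvw.symm, rfl⟩)
    rw [mem_closedBall] at hzv hzw
    have := dist_triangle_left (D.pos w) (D.pos v) z
    have := (hr v).2
    rw [mem_ball]
    linarith
  · rw [disjoint_left]
    intro z hze hzv
    refine hb v ?_ (Or.inr (mem_biUnion (x := e) ⟨he, hve⟩ hze))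
    rw [mem_closedBall] at hzv
    have := (hr v).2
    have : 0 < r := hr0
    rw [mem_ball]
    linarith

theorem exists_isStar [Finite V] (D : PlaneDrawing G) : ∃ (D' : PlaneDrawing G) (r : ℝ),
    D'.IsStar r := by
  obtain ⟨r, hr, hd, hda⟩ := D.exists_radius
  have key : ∀ e : Sym2 V, ∃ B : Set ℂ, e ∈ G.edgeSet →
      (∀ v w, e = s(v, w) → IsSimpleArc B (D.pos v) (D.pos w)) ∧
      (∀ z ∈ B, z ∈ D.arc e ∨ ∃ v ∈ e, z ∈ closedBall (D.pos v) r) ∧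
      ∀ v ∈ e, ∃ p ∈ sphere (D.pos v) r ∩ D.arc e,
        B ∩ closedBall (D.pos v) r = segment ℝ (D.pos v) p := by
    intro e
    induction e with
    | h x y =>
      by_cases he : s(x, y) ∈ G.edgeSet
      · have hxy : x ≠ y := G.ne_of_adj he
        obtain ⟨B, hB, hsub, hx, hy⟩ :=
          (D.arc_isArc _ he x y rfl).exists_straightened hr (hd x y hxy)
        refine ⟨B, fun _ => ⟨fun v w h => ?_, fun z hz => ?_, fun v hv => ?_⟩⟩
        · rcases Sym2.eq_iff.1 h with ⟨rfl, rfl⟩ | ⟨rfl, rfl⟩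
          · exact hB
          · exact hB.symm
        · rcases hsub hz with (hz | hz) | hz
          · exact Or.inl hz
          · exact Or.inr ⟨x, Sym2.mem_mk_left x y, hz⟩
          · exact Or.inr ⟨y, Sym2.mem_mk_right x y, hz⟩
        · rcases Sym2.mem_iff.1 hv with rfl | rfl
          · exact hx
          · exact hy
      · exact ⟨∅, fun h => absurd h he⟩
  choose B hB using key
  have hBd : ∀ v, ∀ e ∈ G.edgeSet, v ∉ e → Disjoint (B e) (closedBall (D.pos v) r) := by
    intro v e he hve
    rw [disjoint_left]
    intro z hz hzv
    rcases (hB e he).2.1 z hz with hz | ⟨w, hw, hzw⟩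
    · exact disjoint_left.1 (hda v e he hve) hz hzv
    · exact disjoint_left.1 (hd v w (by rintro rfl; exact hve hw)) hzv hzw
  refine ⟨⟨D.pos, B, D.pos_inj, fun e he => (hB e he).1, fun e he v hv => ?_,
    fun e he e' he' hne z hz => ?_⟩, r, hr, fun v w hvw => ?_, hBd, fun v e he hve => ?_⟩
  · by_contra hve
    exact disjoint_left.1 (hBd v e he hve) hv (mem_closedBall_self hr.le)
  · by_cases hzv : ∃ v, z ∈ closedBall (D.pos v) r
    · obtain ⟨v, hzv⟩ := hzv
      have hve : v ∈ e := by
        by_contra hve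
        exact disjoint_left.1 (hBd v e he hve) hz.1 hzv
      have hve' : v ∈ e' := by
        by_contra hve
        exact disjoint_left.1 (hBd v e' he' hve) hz.2 hzv
      obtain ⟨p, ⟨hp, hpA⟩, hpe⟩ := (hB e he).2.2 v hve
      obtain ⟨q, ⟨hq, hqA⟩, hqe⟩ := (hB e' he').2.2 v hve'
      have hpq : p ≠ q := by
        rintro rfl
        obtain ⟨w, -, -, rfl⟩ := D.arc_inter e he e' he' hne ⟨hpA, hqA⟩
        by_cases hvw : v = w
        · subst hvw
          simp [hr.ne] at hp
        · exact disjoint_left.1 (hd v w hvw) (sphere_subset_closedBall hp)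
            (mem_closedBall_self hr.le)
      exact ⟨v, hve, hve', (segment_inter_segment_of_sphere hr hp hq hpq
        ⟨hpe.subset ⟨hz.1, hzv⟩, hqe.subset ⟨hz.2, hzv⟩⟩).symm⟩
    · have h1 : z ∈ D.arc e := ((hB e he).2.1 z hz.1).resolve_right fun ⟨v, _, h⟩ => hzv ⟨v, h⟩
      have h2 : z ∈ D.arc e' := ((hB e' he').2.1 z hz.2).resolve_right fun ⟨v, _, h⟩ => hzv ⟨v, h⟩
      exact D.arc_inter e he e' he' hne ⟨h1, h2⟩
  · exact disjoint_right.1 (hd v w hvw) (mem_closedBall_self hr.le)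
  · obtain ⟨p, hp, h⟩ := (hB e he).2.2 v hve
    exact ⟨p, hp.1, h⟩

variable {D : PlaneDrawing G} {r : ℝ}

theorem IsStar.mem_arc_of_mem_image (h : D.IsStar r) {v : V} {z : ℂ} (hz : z ∈ D.image)
    (hzr : z ∈ closedBall (D.pos v) r) :
    z = D.pos v ∨ ∃ w, G.Adj v w ∧ z ∈ D.arc s(v, w) := by
  rcases hz with ⟨w, rfl⟩ | hz
  · by_cases hvw : v = w
    · exact Or.inl (by rw [hvw])
    · exact absurd hzr (h.vertex v w hvw)
  · simp only [mem_iUnion] at hz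
    obtain ⟨e, he, hz⟩ := hz
    by_cases hv : v ∈ e
    · obtain ⟨w, rfl⟩ := Sym2.mem_iff_exists.1 hv
      exact Or.inr ⟨w, he, hz⟩
    · exact absurd hzr (disjoint_left.1 (h.disjoint v e he hv) hz)

theorem IsStar.mem_image_of_smul_mem (h : D.IsStar r) {v : V} {z : ℂ} {s : ℝ}
    (hz : z ∈ closedBall (D.pos v) r) (hs : 0 < s) (hs1 : s ≤ 1)
    (hmem : D.pos v + s • (z - D.pos v) ∈ D.image) : z ∈ D.image := by
  have hball : D.pos v + s • (z - D.pos v) ∈ closedBall (D.pos v) r :=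
    (convex_closedBall _ _).add_smul_sub_mem (mem_closedBall_self h.pos.le) hz ⟨hs.le, hs1⟩
  rcases h.mem_arc_of_mem_image hmem hball with heq | ⟨w, hw, hmem⟩
  · rw [add_eq_left, smul_eq_zero, sub_eq_zero] at heq
    rw [heq.resolve_left hs.ne']
    exact D.pos_mem_image v
  · obtain ⟨p, hp, hseg⟩ := h.radius v s(v, w) hw (Sym2.mem_mk_left v w)
    have hzseg := mem_segment_of_smul_mem hp h.pos hz hs (hseg ▸ ⟨hmem, hball⟩)
    rw [← hseg] at hzseg
    exact arc_subset_image (D := D) (e := s(v, w)) hw hzseg.1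

theorem IsStar.exists_segment_subset (h : D.IsStar r) {v : V} {z₀ : ℂ}
    (hv : D.pos v ∈ closure (connectedComponentIn D.imageᶜ z₀)) :
    ∃ z ∈ connectedComponentIn D.imageᶜ z₀,
      segment ℝ (D.pos v) z ⊆ insert (D.pos v) (connectedComponentIn D.imageᶜ z₀) := by
  obtain ⟨z, hz, hzr⟩ := Metric.mem_closure_iff.1 hv r h.pos
  rw [dist_comm] at hzr
  refine ⟨z, hz, ?_⟩
  have hpre : IsPreconnected ((fun s : ℝ => D.pos v + s • (z - D.pos v)) '' Ioc 0 1) :=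
    isPreconnected_Ioc.image _ (by fun_prop)
  have hsub := hpre.subset_connectedComponentIn (F := D.imageᶜ) (x := z)
    ⟨1, by simp, by simp⟩ (by
      rintro _ ⟨s, hs, rfl⟩ hmem
      exact connectedComponentIn_subset _ _ hz
        (h.mem_image_of_smul_mem (mem_closedBall.2 hzr.le) hs.1 hs.2 hmem))
  rw [← connectedComponentIn_eq hz] at hsub
  rw [segment_eq_image']
  rintro _ ⟨s, hs, rfl⟩
  rcases hs.1.eq_or_lt with rfl | hs0
  · simp
  · exact Or.inr (hsub ⟨s, ⟨hs0, hs.2⟩, rfl⟩)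

open Classical in
theorem IsStar.nonempty_sup_edge [Finite V] (h : D.IsStar r) {a b : V} {z₀ : ℂ} (hab : a ≠ b)
    (ha : D.pos a ∈ closure (connectedComponentIn D.imageᶜ z₀))
    (hb : D.pos b ∈ closure (connectedComponentIn D.imageᶜ z₀)) :
    Nonempty (PlaneDrawing (G ⊔ SimpleGraph.edge a b)) := by
  set F := connectedComponentIn D.imageᶜ z₀ with hF
  obtain ⟨p, hp, hpa⟩ := h.exists_segment_subset ha
  obtain ⟨q, hq, hqb⟩ := h.exists_segment_subset hb
  have hFX : F ⊆ D.imageᶜ := connectedComponentIn_subset _ _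
  have hFo : IsOpen F := D.isCompact_image.isClosed.isOpen_compl.connectedComponentIn
  have hj : ArcJoined (F ∪ {D.pos a, D.pos b}) (D.pos a) (D.pos b) := by
    refine ((arcJoined_of_segment_subset ?_).trans
      ((isPreconnected_connectedComponentIn.arcJoined hFo hp hq).mono subset_union_left)).trans
      (arcJoined_of_segment_subset (S := F ∪ {D.pos a, D.pos b}) (p := D.pos b) (q := q) ?_).symm
    · exact hpa.trans (by rintro z (rfl | hz) <;> simp_all)
    · exact hqb.trans (by rintro z (rfl | hz) <;> simp_all)
  obtain ⟨A, hA, harc⟩ := hj.resolve_left fun h => hab (D.pos_inj h)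
  have hAX : ∀ z ∈ A, z ∈ D.image → z = D.pos a ∨ z = D.pos b := fun z hz hzX =>
    (hA hz).resolve_left fun hzF => hFX hzF hzX
  have hedge : ∀ e, e ∈ (G ⊔ SimpleGraph.edge a b).edgeSet → e ≠ s(a, b) → e ∈ G.edgeSet := by
    intro e he hne
    rw [SimpleGraph.edgeSet_sup, SimpleGraph.edgeSet_edge_of_ne hab] at he
    exact he.resolve_right hne
  have hinter : ∀ e ∈ G.edgeSet, A ∩ D.arc e ⊆
      {x | ∃ v : V, v ∈ s(a, b) ∧ v ∈ e ∧ D.pos v = x} := by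
    rintro e he z ⟨hzA, hze⟩
    rcases hAX z hzA (arc_subset_image he hze) with rfl | rfl
    · exact ⟨a, by simp, D.arc_vertex e he a hze, rfl⟩
    · exact ⟨b, by simp, D.arc_vertex e he b hze, rfl⟩
  refine ⟨⟨D.pos, Function.update D.arc s(a, b) A, D.pos_inj, ?_, ?_, ?_⟩⟩
  · intro e he v w hvw
    by_cases hne : e = s(a, b)
    · subst hne
      rw [Function.update_self]
      rcases Sym2.eq_iff.1 hvw with ⟨rfl, rfl⟩ | ⟨rfl, rfl⟩
      · exact harc
      · exact harc.symm
    · rw [Function.update_of_ne hne]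
      exact D.arc_isArc e (hedge e he hne) v w hvw
  · intro e he v hv
    by_cases hne : e = s(a, b)
    · subst hne
      rw [Function.update_self] at hv
      rw [Sym2.mem_iff]
      exact (hAX _ hv (D.pos_mem_image v)).imp (fun h => D.pos_inj h) fun h => D.pos_inj h
    · rw [Function.update_of_ne hne] at hv
      exact D.arc_vertex e (hedge e he hne) v hv
  · intro e he e' he' hee
    by_cases hne : e = s(a, b)
    · subst hne
      rw [Function.update_self, Function.update_of_ne hee.symm]
      exact hinter e' (hedge e' he' hee.symm)
    · by_cases hne' : e' = s(a, b)
      · subst hne'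
        rw [Function.update_self, Function.update_of_ne hee, inter_comm]
        exact (hinter e (hedge e he hee)).trans fun x ⟨v, h1, h2, h3⟩ => ⟨v, h2, h1, h3⟩
      · rw [Function.update_of_ne hne, Function.update_of_ne hne']
        exact D.arc_inter e (hedge e he hne) e' (hedge e' he' hne') hee

/-- Two disjoint sides of a graph without edges between them touch a common region. -/
theorem exists_common_region_of_disconnected [Finite V] (D : PlaneDrawing G) {A B : Set V}
    (hA : A.Nonempty) (hB : B.Nonempty) (hdisj : Disjoint A B) (huniv : A ∪ B = univ)
    (hno : ∀ a ∈ A, ∀ b ∈ B, ¬ G.Adj a b) :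
    ∃ a ∈ A, ∃ b ∈ B, ∃ z₀, D.pos a ∈ closure (connectedComponentIn D.imageᶜ z₀) ∧
      D.pos b ∈ closure (connectedComponentIn D.imageᶜ z₀) := by
  let Y : Set V → Set ℂ := fun S => D.pos '' S ∪ ⋃ e ∈ {e ∈ G.edgeSet | ∀ v ∈ e, v ∈ S}, D.arc e
  have hYc : ∀ S, IsCompact (Y S) := fun S => (toFinite _).isCompact.union
    ((toFinite _).isCompact_biUnion fun _ he => D.isCompact_arc he.1)
  have hYne : ∀ S : Set V, S.Nonempty → (Y S).Nonempty := fun S hS => (hS.image _).inl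
  have hAB : ∀ v, v ∈ A ∨ v ∈ B := fun v => by
    have : v ∈ A ∪ B := huniv ▸ mem_univ v
    exact this
  have hX : D.image ⊆ Y A ∪ Y B := by
    rintro z (⟨v, rfl⟩ | hz)
    · exact (hAB v).imp (fun h => Or.inl ⟨v, h, rfl⟩) fun h => Or.inl ⟨v, h, rfl⟩
    · simp only [mem_iUnion] at hz
      obtain ⟨e, he, hz⟩ := hz
      induction e with
      | h v w =>
        rcases hAB v with hv | hv <;> rcases hAB w with hw | hw
        · exact Or.inl (Or.inr (mem_biUnion (x := s(v, w)) ⟨he, by simp [hv, hw]⟩ hz))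
        · exact absurd he (hno v hv w hw)
        · exact absurd (G.adj_symm he) (hno w hw v hv)
        · exact Or.inr (Or.inr (mem_biUnion (x := s(v, w)) ⟨he, by simp [hv, hw]⟩ hz))
  have hYd : Disjoint (Y A) (Y B) := by
    rw [disjoint_left]
    rintro z (⟨v, hv, rfl⟩ | hz) (⟨w, hw, hwz⟩ | hz')
    · exact disjoint_left.1 hdisj hv (D.pos_inj hwz ▸ hw)
    · simp only [mem_iUnion] at hz'
      obtain ⟨e, he, hz'⟩ := hz'
      exact disjoint_left.1 hdisj hv (he.2 v (D.arc_vertex e he.1 v hz'))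
    · simp only [mem_iUnion] at hz
      obtain ⟨e, he, hz⟩ := hz
      exact disjoint_left.1 hdisj (he.2 w (D.arc_vertex e he.1 w (hwz ▸ hz))) hw
    · simp only [mem_iUnion] at hz hz'
      obtain ⟨e, he, hz⟩ := hz
      obtain ⟨e', he', hz'⟩ := hz'
      have hee : e ≠ e' := by
        rintro rfl
        induction e with
        | h v w =>
          exact disjoint_left.1 hdisj (he.2 v (Sym2.mem_mk_left v w))
            (he'.2 v (Sym2.mem_mk_left v w))
      obtain ⟨v, hve, hve', -⟩ := D.arc_inter e he.1 e' he'.1 hee ⟨hz, hz'⟩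
      exact disjoint_left.1 hdisj (he.2 v hve) (he'.2 v hve')
  obtain ⟨⟨p, q⟩, ⟨hp, hq⟩, hmin⟩ := ((hYc A).prod (hYc B)).exists_isMinOn
    ((hYne A hA).prod (hYne B hB)) (f := fun z : ℂ × ℂ => dist z.1 z.2)
    (by fun_prop)
  have hpq : p ≠ q := fun h => disjoint_left.1 hYd hp (h ▸ hq)
  have hseg : openSegment ℝ p q ⊆ D.imageᶜ := by
    intro z hz hzX
    rw [openSegment_eq_image_lineMap] at hz
    obtain ⟨t, ht, rfl⟩ := hz
    have hd : 0 < dist p q := dist_pos.2 hpq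
    rcases hX hzX with hz | hz
    · have := hmin (show (AffineMap.lineMap p q t, q) ∈ Y A ×ˢ Y B from ⟨hz, hq⟩)
      simp only [mem_ofPred_eq, dist_lineMap_right] at this
      rw [Real.norm_of_nonneg (by linarith [ht.2])] at this
      nlinarith [ht.1]
    · have := hmin (show (p, AffineMap.lineMap p q t) ∈ Y A ×ˢ Y B from ⟨hp, hz⟩)
      simp only [mem_ofPred_eq, dist_left_lineMap] at this
      rw [Real.norm_of_nonneg ht.1.le] at this
      nlinarith [ht.2]
  obtain ⟨z₀, hz₀⟩ : (openSegment ℝ p q).Nonempty :=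
    ⟨AffineMap.lineMap p q (1 / 2 : ℝ), by
      rw [openSegment_eq_image_lineMap]; exact ⟨1 / 2, by norm_num, rfl⟩⟩
  have hcl : segment ℝ p q ⊆ closure (connectedComponentIn D.imageᶜ z₀) := by
    rw [← closure_openSegment]
    exact closure_mono ((convex_openSegment p q).isPreconnected.subset_connectedComponentIn
      hz₀ hseg)
  have slide : ∀ S : Set V, ∀ p ∈ Y S, p ∈ closure (connectedComponentIn D.imageᶜ z₀) →
      ∃ a ∈ S, D.pos a ∈ closure (connectedComponentIn D.imageᶜ z₀) := by
    rintro S p (⟨v, hv, rfl⟩ | hz) hcl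
    · exact ⟨v, hv, hcl⟩
    · simp only [mem_iUnion] at hz
      obtain ⟨e, he, hz⟩ := hz
      induction e with
      | h v w =>
        by_cases hpv : p = D.pos v
        · exact ⟨v, he.2 v (Sym2.mem_mk_left v w), hpv ▸ hcl⟩
        · exact ⟨w, he.2 w (Sym2.mem_mk_right v w), D.end_mem_closure_component he.1 hz hpv hcl⟩
  obtain ⟨a, ha, hac⟩ := slide A p hp (hcl (left_mem_segment ℝ p q))
  obtain ⟨b, hb, hbc⟩ := slide B q hq (hcl (right_mem_segment ℝ p q))
  exact ⟨a, ha, b, hb, z₀, hac, hbc⟩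

/-- The edges at `x` leave the star disc at `x` through distinct points of its boundary, given
by angles in a half-open interval of length `2 * π` starting at any neighbour `y`. -/
theorem IsStar.exists_angle (h : D.IsStar r) (x y : V) :
    ∃ θ : V → ℝ, (∀ u, G.Adj x u → circleMap (D.pos x) r (θ u) ∈ D.arc s(x, u)) ∧
      (∀ u, G.Adj x u → ∀ z ∈ sphere (D.pos x) r, z ∈ D.arc s(x, u) →
        z = circleMap (D.pos x) r (θ u)) ∧
      ∀ u, θ u ∈ Ico (θ y) (θ y + 2 * Real.pi) := by
  have key : ∀ u, ∃ t : ℝ, G.Adj x u → circleMap (D.pos x) r t ∈ D.arc s(x, u) ∧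
      ∀ z ∈ sphere (D.pos x) r, z ∈ D.arc s(x, u) → z = circleMap (D.pos x) r t := by
    intro u
    by_cases hu : G.Adj x u
    · obtain ⟨p, hp, hseg⟩ := h.radius x s(x, u) hu (Sym2.mem_mk_left x u)
      have hpr : p ∈ range (circleMap (D.pos x) r) := by
        rw [range_circleMap, abs_of_pos h.pos]; exact hp
      obtain ⟨t, rfl⟩ := hpr
      refine ⟨t, fun _ => ⟨(hseg ▸ right_mem_segment ℝ _ _ :
        circleMap (D.pos x) r t ∈ D.arc s(x, u) ∩ closedBall (D.pos x) r).1, fun z hz hza => ?_⟩⟩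
      have hzs : z ∈ segment ℝ (D.pos x) (circleMap (D.pos x) r t) :=
        hseg ▸ ⟨hza, sphere_subset_closedBall hz⟩
      by_contra hne
      have := segment_inter_segment_of_sphere h.pos hp hz (Ne.symm hne)
        ⟨hzs, right_mem_segment ℝ _ _⟩
      rw [mem_singleton_iff] at this
      rw [this, mem_sphere, dist_self] at hz
      exact h.pos.ne hz
    · exact ⟨0, fun h => absurd h hu⟩
  choose t ht using key
  have hper : ∀ u, ∃ s ∈ Ico (t y) (t y + 2 * Real.pi),
      circleMap (D.pos x) r (t u) = circleMap (D.pos x) r s := fun u =>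
    (periodic_circleMap (D.pos x) r).exists_mem_Ico Real.two_pi_pos (t u) (t y)
  choose s hs hst using hper
  have hsy : s y = t y := by
    refine injOn_circleMap_of_abs_sub_le' h.pos.ne' (by linarith) (hs y) ?_ (hst y).symm
    simp [Real.pi_pos]
  refine ⟨s, fun u hu => hst u ▸ (ht u hu).1, fun u hu => hst u ▸ (ht u hu).2, ?_⟩
  rw [hsy]
  exact hs

/-- If the neighbours of `x` other than `y` lie on two sides and both sides occur, then the two
sides touch a common region. -/
theorem IsStar.exists_common_region [Finite V] (h : D.IsStar r) {x y : V} {A B : Set V}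
    (hAB : Disjoint A B) (hcov : ∀ u, G.Adj x u → u ≠ y → u ∈ A ∨ u ∈ B)
    (hA : ∃ a ∈ A, G.Adj x a) (hB : ∃ b ∈ B, G.Adj x b) :
    ∃ a ∈ A, ∃ b ∈ B, ∃ z₀, D.pos a ∈ closure (connectedComponentIn D.imageᶜ z₀) ∧
      D.pos b ∈ closure (connectedComponentIn D.imageᶜ z₀) := by
  obtain ⟨θ, hθ, hθu, hθI⟩ := h.exists_angle x y
  have hpx : ∀ s, circleMap (D.pos x) r s ≠ D.pos x := fun s heq => by
    have hsph : circleMap (D.pos x) r s ∈ sphere (D.pos x) r := circleMap_mem_sphere _ h.pos.le _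
    rw [heq, mem_sphere, dist_self] at hsph
    exact h.pos.ne hsph
  have hinj : ∀ u w, G.Adj x u → G.Adj x w → θ u = θ w → u = w := by
    intro u w hu hw huw
    by_contra hne
    obtain ⟨v, hv, hv', hvz⟩ := D.arc_inter s(x, u) hu s(x, w) hw
      (fun h => hne (Sym2.congr_right.1 h)) ⟨hθ u hu, huw ▸ hθ w hw⟩
    have hvx : v = x := by
      rw [Sym2.mem_iff] at hv hv'
      rcases hv with hv | rfl
      · exact hv
      · exact hv'.resolve_right hne
    exact hpx _ (hvx ▸ hvz).symm
  obtain ⟨a₀, ha₀, hxa₀⟩ := hA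
  obtain ⟨b₀, hb₀, hxb₀⟩ := hB
  obtain ⟨⟨a, b⟩, ⟨⟨ha, hxa⟩, hb, hxb⟩, hmin⟩ := exists_min_image
    ({a ∈ A | G.Adj x a} ×ˢ {b ∈ B | G.Adj x b}) (fun c : V × V => |θ c.1 - θ c.2|)
    (toFinite _) ⟨(a₀, b₀), ⟨ha₀, hxa₀⟩, hb₀, hxb₀⟩
  have hne : θ a ≠ θ b := fun hab => disjoint_left.1 hAB ha (hinj a b hxa hxb hab ▸ hb)
  have hno : ∀ u, G.Adj x u → θ u ∉ Ioo (min (θ a) (θ b)) (max (θ a) (θ b)) := by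
    intro u hu hI
    have huy : u ≠ y := by
      rintro rfl
      have h1 := (hθI a).1
      have h2 := (hθI b).1
      exact absurd hI.1 (not_lt.2 (le_min h1 h2))
    rcases hcov u hu huy with hu' | hu'
    · have hle := hmin (u, b) ⟨⟨hu', hu⟩, hb, hxb⟩
      rcases lt_or_gt_of_ne hne with hab | hab
      · rw [min_eq_left hab.le, max_eq_right hab.le] at hI
        simp only at hle
        rw [abs_of_neg (by linarith), abs_of_neg (by linarith [hI.2])] at hle
        linarith [hI.1]
      · rw [min_eq_right hab.le, max_eq_left hab.le] at hI
        simp only at hle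
        rw [abs_of_pos (by linarith), abs_of_pos (by linarith [hI.1])] at hle
        linarith [hI.2]
    · have hle := hmin (a, u) ⟨⟨ha, hxa⟩, hu', hu⟩
      rcases lt_or_gt_of_ne hne with hab | hab
      · rw [min_eq_left hab.le, max_eq_right hab.le] at hI
        simp only at hle
        rw [abs_of_neg (by linarith), abs_of_neg (by linarith [hI.1])] at hle
        linarith [hI.2]
      · rw [min_eq_right hab.le, max_eq_left hab.le] at hI
        simp only at hle
        rw [abs_of_pos (by linarith), abs_of_pos (by linarith [hI.2])] at hle
        linarith [hI.1]
  set I := Ioo (min (θ a) (θ b)) (max (θ a) (θ b)) with hIdef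
  have hlt : min (θ a) (θ b) < max (θ a) (θ b) := min_lt_max.2 hne
  have hIsub : ∀ s ∈ I, s ∈ Ico (θ y) (θ y + 2 * Real.pi) := fun s hs =>
    ⟨(le_min (hθI a).1 (hθI b).1).trans hs.1.le, hs.2.trans (max_lt (hθI a).2 (hθI b).2)⟩
  have hX : circleMap (D.pos x) r '' I ⊆ D.imageᶜ := by
    rintro _ ⟨s, hs, rfl⟩ hmem
    have hsph : circleMap (D.pos x) r s ∈ sphere (D.pos x) r := circleMap_mem_sphere _ h.pos.le _
    rcases h.mem_arc_of_mem_image hmem (sphere_subset_closedBall hsph) with heq | ⟨u, hu, hmem⟩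
    · exact hpx s heq
    · have := injOn_circleMap_of_abs_sub_le' h.pos.ne' (by linarith) (hIsub s hs) (hθI u)
        (hθu u hu _ hsph hmem)
      exact hno u hu (this ▸ hs)
  obtain ⟨s₀, hs₀⟩ : I.Nonempty := nonempty_Ioo.2 hlt
  have hsub : circleMap (D.pos x) r '' I ⊆
      connectedComponentIn D.imageᶜ (circleMap (D.pos x) r s₀) :=
    (isPreconnected_Ioo.image _ (continuous_circleMap _ _).continuousOn).subset_connectedComponentIn
      (mem_image_of_mem _ hs₀) hX
  have hcl : ∀ s ∈ Icc (min (θ a) (θ b)) (max (θ a) (θ b)), circleMap (D.pos x) r s ∈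
      closure (connectedComponentIn D.imageᶜ (circleMap (D.pos x) r s₀)) := by
    intro s hs
    rw [← closure_Ioo hlt.ne] at hs
    exact closure_mono hsub (image_closure_subset_closure_image (continuous_circleMap _ _)
      (mem_image_of_mem _ hs))
  exact ⟨a, ha, b, hb, _,
    D.end_mem_closure_component hxa (hθ a hxa) (hpx _) (hcl _ ⟨min_le_left _ _, le_max_left _ _⟩),
    D.end_mem_closure_component hxb (hθ b hxb) (hpx _) (hcl _ ⟨min_le_right _ _, le_max_right _ _⟩)⟩

end PlaneDrawing

/-- The stereographic projection from `n`, with the plane identified with `ℂ`. -/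
theorem exists_stereographic_complex (n : Sphere2) : ∃ (φ : ℂ → Sphere2) (ψ : Sphere2 → ℂ),
    Continuous φ ∧ ContinuousOn ψ {n}ᶜ ∧ (∀ z, φ z ≠ n) ∧ (∀ z, ψ (φ z) = z) ∧
      ∀ x, x ≠ n → φ (ψ x) = x := by
  have : Fact (Module.finrank ℝ (EuclideanSpace ℝ (Fin 3)) = 2 + 1) := ⟨by simp⟩
  let e := stereographic' 2 n
  have hes : e.source = {n}ᶜ := stereographic'_source n
  have het : e.target = univ := stereographic'_target n
  let L : ℂ ≃ₗᵢ[ℝ] EuclideanSpace ℝ (Fin 2) := Complex.orthonormalBasisOneI.repr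
  have hmem : ∀ y, y ∈ e.target := fun y => het ▸ mem_univ y
  refine ⟨fun z => e.symm (L z), fun x => L.symm (e x), ?_, ?_, ?_, ?_, ?_⟩
  · have : Continuous e.symm := by
      rw [← continuousOn_univ, ← het]; exact e.continuousOn_symm
    exact this.comp L.continuous
  · rw [← hes]
    exact L.symm.continuous.comp_continuousOn e.continuousOn
  · intro z
    have := e.map_target (hmem (L z))
    rwa [hes] at this
  · intro z
    simp [e.right_inv (hmem (L z))]
  · intro x hx
    simp only [LinearIsometryEquiv.apply_symm_apply]
    exact e.left_inv (hes ▸ hx)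

/-- There is no continuous injection from a nonempty open subset of the plane to the line. -/
theorem not_injOn_of_isOpen_complex {U : Set ℂ} (hU : IsOpen U) {z : ℂ} (hz : z ∈ U) {h : ℂ → ℝ}
    (hc : ContinuousOn h U) : ¬ InjOn h U := by
  intro hi
  obtain ⟨ε, hε, hsub⟩ := Metric.isOpen_iff.1 hU z hz
  have hcirc : ∀ t, circleMap z (ε / 2) t ∈ U := fun t => hsub (by
    have := circleMap_mem_closedBall z (half_pos hε).le t
    exact mem_ball.2 (lt_of_le_of_lt (mem_closedBall.1 this) (half_lt_self hε)))
  let k : ℝ → ℝ := fun t => h (circleMap z (ε / 2) t)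
  have hk : Continuous k := hc.comp_continuous (continuous_circleMap _ _) hcirc
  have hper : ∀ t, k (t + 2 * Real.pi) = k t := fun t => by
    simp only [k, periodic_circleMap z (ε / 2) t]
  let d : ℝ → ℝ := fun t => k (t + Real.pi) - k t
  have hd : Continuous d := by fun_prop
  have hdπ : d Real.pi = - d 0 := by
    have := hper 0
    simp only [d, zero_add] at this ⊢
    rw [← two_mul, this]; ring
  obtain ⟨t, ht⟩ : ∃ t, d t = 0 := by
    have hr := isPreconnected_univ.image d hd.continuousOn
    have h0 : d 0 ∈ d '' univ := mem_image_of_mem _ (mem_univ _)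
    have h1 : d Real.pi ∈ d '' univ := mem_image_of_mem _ (mem_univ _)
    have : (0 : ℝ) ∈ d '' univ := by
      rcases le_total (d 0) 0 with h | h
      · exact hr.Icc_subset h0 h1 ⟨h, by linarith⟩
      · exact hr.Icc_subset h1 h0 ⟨by linarith, h⟩
    obtain ⟨t, -, ht⟩ := this
    exact ⟨t, ht⟩
  have heq := hi (hcirc _) (hcirc _) (sub_eq_zero.1 ht)
  have hne := injOn_circleMap_of_abs_sub_le' (a := t) (b := t + 2 * Real.pi) (c := z)
    (half_pos hε).ne' (by linarith) ⟨by linarith [Real.pi_pos], by linarith [Real.pi_pos]⟩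
    ⟨le_rfl, by linarith [Real.pi_pos]⟩ heq
  linarith [Real.pi_pos]

theorem IsArc.interior_eq_empty {A : Set Sphere2} {x y : Sphere2} (h : IsArc A x y) :
    interior A = ∅ := by
  obtain ⟨f, hc, hi, -, -, rfl⟩ := h
  obtain ⟨g, hg, hgf⟩ := exists_continuousOn_leftInvOn hc hi
  by_contra hne
  obtain ⟨u, hu⟩ := nonempty_iff_ne_empty.2 hne
  have hun : u ≠ -u := ne_neg_of_mem_unit_sphere ℝ u
  obtain ⟨φ, ψ, hφ, -, -, hψφ, hφψ⟩ := exists_stereographic_complex (-u)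
  refine not_injOn_of_isOpen_complex (isOpen_interior.preimage hφ) (z := ψ u)
    (by rw [mem_preimage, hφψ u hun]; exact hu) (h := g ∘ φ)
    (hg.comp hφ.continuousOn fun z hz => interior_subset hz) ?_
  intro z hz w hw hzw
  obtain ⟨s, hs, hsz⟩ := interior_subset hz
  obtain ⟨t, ht, htw⟩ := interior_subset hw
  simp only [Function.comp_apply, ← hsz, ← htw, hgf s hs, hgf t ht] at hzw
  rw [← hψφ z, ← hψφ w, ← hsz, ← htw, hzw]

theorem interior_singleton_sphere2 (u : Sphere2) : interior ({u} : Set Sphere2) = ∅ := by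
  by_contra hne
  obtain ⟨v, hv⟩ := nonempty_iff_ne_empty.2 hne
  obtain rfl : v = u := mem_singleton_iff.1 (interior_subset hv)
  obtain ⟨φ, ψ, hφ, -, -, hψφ, hφψ⟩ := exists_stereographic_complex (-v)
  refine not_injOn_of_isOpen_complex (isOpen_interior.preimage hφ) (z := ψ v)
    (by rw [mem_preimage, hφψ v (ne_neg_of_mem_unit_sphere ℝ v)]; exact hv) (h := fun _ => 0)
    continuousOn_const fun z hz w hw _ => ?_
  have hzw : φ z = φ w :=
    (mem_singleton_iff.1 (interior_subset hz)).trans (mem_singleton_iff.1 (interior_subset hw)).symm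
  rw [← hψφ z, ← hψφ w, hzw]

theorem interior_biUnion_eq_empty {X ι : Type*} [TopologicalSpace X] {s : Set ι} (hs : s.Finite)
    {f : ι → Set X} (hc : ∀ i ∈ s, IsClosed (f i)) (hi : ∀ i ∈ s, interior (f i) = ∅) :
    interior (⋃ i ∈ s, f i) = ∅ := by
  induction s, hs using Set.Finite.induction_on with
  | empty => simp
  | @insert a s _ hs ih =>
    rw [biUnion_insert, interior_union_isClosed_of_interior_empty (hc a (mem_insert a s))]
    · exact hi a (mem_insert a s)
    · exact ih (fun i h => hc i (mem_insert_of_mem a h)) fun i h => hi i (mem_insert_of_mem a h)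

theorem SphereEmbedding.exists_notMem_image {V : Type*} [Finite V] {G : SimpleGraph V}
    (D : SphereEmbedding G) : ∃ n, n ∉ D.image := by
  have hclosed : ∀ e ∈ G.edgeSet, IsClosed (D.arc e) ∧ interior (D.arc e) = ∅ := by
    intro e he
    induction e with
    | h v w =>
      have harc := D.arc_isArc _ he v w rfl
      exact ⟨(IsSimpleArc.isCompact harc).isClosed, harc.interior_eq_empty⟩
  have hE : interior (⋃ e ∈ G.edgeSet, D.arc e) = ∅ :=
    interior_biUnion_eq_empty (toFinite _) (fun e he => (hclosed e he).1)
      fun e he => (hclosed e he).2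
  have hfin : (range D.pos).Finite := finite_range _
  have hP : interior (range D.pos) = ∅ := by
    rw [← biUnion_of_singleton (range D.pos)]
    exact interior_biUnion_eq_empty hfin (fun v _ => isClosed_singleton) fun v _ =>
      interior_singleton_sphere2 v
  have hX : interior D.image = ∅ := by
    rw [SphereEmbedding.image, interior_union_isClosed_of_interior_empty hfin.isClosed hE, hP]
  by_contra! hall
  rw [eq_univ_of_forall hall, interior_univ] at hX
  exact (hX ▸ mem_univ (⟨EuclideanSpace.single 0 1, by simp⟩ : Sphere2) : _ ∈ (∅ : Set Sphere2))

theorem SphereEmbedding.nonempty_planeDrawing {V : Type*} [Finite V] {G : SimpleGraph V}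
    (D : SphereEmbedding G) : Nonempty (PlaneDrawing G) := by
  obtain ⟨n, hn⟩ := D.exists_notMem_image
  obtain ⟨φ, ψ, -, hψ, -, -, hφψ⟩ := exists_stereographic_complex n
  have hpos : ∀ v, D.pos v ≠ n := fun v h => hn (Or.inl ⟨v, h⟩)
  have harc : ∀ e ∈ G.edgeSet, D.arc e ⊆ {n}ᶜ := by
    rintro e he z hz rfl
    exact hn (Or.inr (mem_biUnion he hz))
  have hinj : InjOn ψ {n}ᶜ := fun x hx y hy hxy => by rw [← hφψ x hx, ← hφψ y hy, hxy]
  refine ⟨⟨fun v => ψ (D.pos v), fun e => ψ '' D.arc e, ?_, ?_, ?_, ?_⟩⟩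
  · exact fun v w h => D.pos_inj (hinj (hpos v) (hpos w) h)
  · intro e he v w hvw
    exact IsSimpleArc.image (D.arc_isArc e he v w hvw) (hψ.mono (harc e he)) (hinj.mono (harc e he))
  · rintro e he v ⟨z, hz, hzv⟩
    exact D.arc_vertex e he v (hinj (harc e he hz) (hpos v) hzv ▸ hz)
  · rintro e he e' he' hne _ ⟨⟨z, hz, rfl⟩, w, hw, hwz⟩
    obtain rfl := hinj (harc e' he' hw) (harc e he hz) hwz
    obtain ⟨v, hv, hv', rfl⟩ := D.arc_inter e he e' he' hne ⟨hz, hw⟩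
    exact ⟨v, hv, hv', rfl⟩

theorem PlaneDrawing.isPlanar {V : Type*} {G : SimpleGraph V} (D : PlaneDrawing G) :
    G.IsPlanar := by
  obtain ⟨φ, ψ, hφ, -, -, hψφ, -⟩ :=
    exists_stereographic_complex ⟨EuclideanSpace.single 0 1, by simp⟩
  have hinj : Function.Injective φ := Function.LeftInverse.injective hψφ
  refine ⟨⟨fun v => φ (D.pos v), fun e => φ '' D.arc e, hinj.comp D.pos_inj, ?_, ?_, ?_⟩⟩
  · intro e he v w hvw
    exact IsSimpleArc.image (D.arc_isArc e he v w hvw) hφ.continuousOn hinj.injOn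
  · rintro e he v ⟨z, hz, hzv⟩
    exact D.arc_vertex e he v (hinj hzv ▸ hz)
  · rintro e he e' he' hne _ ⟨⟨z, hz, rfl⟩, w, hw, hwz⟩
    obtain rfl := hinj hwz
    obtain ⟨v, hv, hv', rfl⟩ := D.arc_inter e he e' he' hne ⟨hz, hw⟩
    exact ⟨v, hv, hv', rfl⟩

/-- `A` and `B` are nonempty disjoint vertex sets without edges between them. -/
structure IsSeparated {V : Type*} (G : SimpleGraph V) (A B : Set V) : Prop where
  left : A.Nonempty
  right : B.Nonempty
  disj : Disjoint A B
  not_adj : ∀ a ∈ A, ∀ b ∈ B, ¬ G.Adj a b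

theorem IsSeparated.symm {V : Type*} {G : SimpleGraph V} {A B : Set V} (h : IsSeparated G A B) :
    IsSeparated G B A :=
  ⟨h.right, h.left, h.disj.symm, fun b hb a ha hab => h.not_adj a ha b hb hab.symm⟩

theorem IsSeparated.insert_left {V : Type*} {G : SimpleGraph V} {A B : Set V}
    (h : IsSeparated G A B) {x : V} (hxB : x ∉ B) (hx : ∀ b ∈ B, ¬ G.Adj x b) :
    IsSeparated G (insert x A) B := by
  refine ⟨insert_nonempty x A, h.right, disjoint_insert_left.2 ⟨hxB, h.disj⟩, ?_⟩
  rintro a (rfl | ha)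
  · exact hx
  · exact h.not_adj a ha

namespace IsMaximalPlanar

variable {V : Type*} [Finite V] {G : SimpleGraph V} {A B : Set V}

theorem exists_isStar (hmax : IsMaximalPlanar G) : ∃ (D : PlaneDrawing G) (r : ℝ), D.IsStar r := by
  obtain ⟨⟨D⟩, -⟩ := hmax
  obtain ⟨D⟩ := D.nonempty_planeDrawing
  exact D.exists_isStar

theorem adj_of_mem_closure (hmax : IsMaximalPlanar G) {D : PlaneDrawing G} {r : ℝ}
    (hD : D.IsStar r) {a b : V} (hab : a ≠ b) {z : ℂ}
    (ha : D.pos a ∈ closure (connectedComponentIn D.imageᶜ z))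
    (hb : D.pos b ∈ closure (connectedComponentIn D.imageᶜ z)) : G.Adj a b := by
  obtain ⟨D'⟩ := hD.nonempty_sup_edge hab ha hb
  rw [← hmax.2 _ le_sup_left D'.isPlanar]
  exact Or.inr (by simp [SimpleGraph.edge_adj, hab])

theorem exists_notMem_of_isSeparated (hmax : IsMaximalPlanar G) (h : IsSeparated G A B) :
    ∃ x, x ∉ A ∪ B := by
  by_contra! hall
  obtain ⟨D, r, hD⟩ := hmax.exists_isStar
  obtain ⟨a, ha, b, hb, z, haz, hbz⟩ := D.exists_common_region_of_disconnected h.left h.right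
    h.disj (eq_univ_of_forall hall) h.not_adj
  exact h.not_adj a ha b hb
    (hmax.adj_of_mem_closure hD (fun hab => disjoint_left.1 h.disj ha (hab ▸ hb)) haz hbz)

theorem not_adj_both_of_isSeparated (hmax : IsMaximalPlanar G) (h : IsSeparated G A B) {x y : V}
    (hxy : ∀ u, u ∉ A ∪ B → u = x ∨ u = y) :
    (∀ a ∈ A, ¬ G.Adj x a) ∨ ∀ b ∈ B, ¬ G.Adj x b := by
  by_contra! hcon
  obtain ⟨D, r, hD⟩ := hmax.exists_isStar
  obtain ⟨a, ha, b, hb, z, haz, hbz⟩ := hD.exists_common_region (y := y) h.disj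
    (fun u hu huy => by
      by_contra hAB
      exact (hxy u hAB).elim (fun h => G.ne_of_adj hu h.symm) huy) hcon.1 hcon.2
  exact h.not_adj a ha b hb
    (hmax.adj_of_mem_closure hD (fun hab => disjoint_left.1 h.disj ha (hab ▸ hb)) haz hbz)

/-- A vertex outside a separation of order at most two can be moved to one of the sides. -/
theorem exists_isSeparated_insert (hmax : IsMaximalPlanar G) (h : IsSeparated G A B) {x y : V}
    (hxy : ∀ u, u ∉ A ∪ B → u = x ∨ u = y) :
    ∃ A' B', IsSeparated G A' B' ∧ A' ∪ B' = insert x (A ∪ B) := by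
  by_cases hx : x ∈ A ∪ B
  · exact ⟨A, B, h, (insert_eq_of_mem hx).symm⟩
  · have hxA : x ∉ A := fun h => hx (Or.inl h)
    have hxB : x ∉ B := fun h => hx (Or.inr h)
    rcases hmax.not_adj_both_of_isSeparated h hxy with hn | hn
    · exact ⟨A, insert x B, (h.symm.insert_left hxA hn).symm, union_insert⟩
    · exact ⟨insert x A, B, h.insert_left hxB hn, insert_union⟩

theorem not_isSeparated (hmax : IsMaximalPlanar G) {x y : V}
    (hxy : ∀ u, u ∉ A ∪ B → u = x ∨ u = y) : ¬ IsSeparated G A B := by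
  intro h
  obtain ⟨A', B', h', hAB'⟩ := hmax.exists_isSeparated_insert h hxy
  obtain ⟨A'', B'', h'', hAB''⟩ := hmax.exists_isSeparated_insert (x := y) (y := y) h'
    fun u hu => by
      rw [hAB', mem_insert_iff, not_or] at hu
      exact Or.inl ((hxy u hu.2).resolve_left hu.1)
  obtain ⟨u, hu⟩ := hmax.exists_notMem_of_isSeparated h''
  rw [hAB'', hAB', mem_insert_iff, mem_insert_iff, not_or, not_or] at hu
  exact (hxy u hu.2.2).elim hu.2.1 hu.1

end IsMaximalPlanar

theorem Set.exists_subset_pair_of_ncard_le_two {α : Type*} [Finite α] [Nonempty α] {s : Set α}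
    (hs : s.ncard ≤ 2) : ∃ x y, s ⊆ {x, y} := by
  rcases s.eq_empty_or_nonempty with rfl | ⟨x, hx⟩
  · exact ⟨Classical.arbitrary α, Classical.arbitrary α, empty_subset _⟩
  · have hcard : (s \ {x}).ncard ≤ 1 := by
      have := ncard_sdiff_singleton_add_one hx
      omega
    rcases (s \ {x}).eq_empty_or_nonempty with h | ⟨y, hy⟩
    · exact ⟨x, x, by simpa [sdiff_eq_empty] using h⟩
    · refine ⟨x, y, fun z hz => ?_⟩
      by_cases hzx : z = x
      · exact Or.inl hzx
      · exact Or.inr ((ncard_le_one_iff (toFinite _)).1 hcard ⟨hz, hzx⟩ hy)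

/-- Every maximal planar graph on at least 4 vertices is 3-connected. -/
theorem stmt8 {V : Type*} [Fintype V] (G : SimpleGraph V)
    (hmax : IsMaximalPlanar G) (h4 : 4 ≤ Fintype.card V) :
    ThreeConnected G := by
  refine ⟨h4, fun s hs => ?_⟩
  have : Nonempty V := Fintype.card_pos_iff.1 (by omega)
  obtain ⟨x, y, hxy⟩ := exists_subset_pair_of_ncard_le_two hs
  set H := ((⊤ : G.Subgraph).deleteVerts s) with hH
  have hverts : ∀ v, v ∈ H.verts ↔ v ∉ s := fun v => by simp [hH]
  have hadj : ∀ u v : H.verts, G.Adj u v → H.coe.Adj u v := fun u v huv => by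
    simp [hH, huv, (hverts u).1 u.2, (hverts v).1 v.2]
  have hne : Nonempty H.verts := by
    obtain ⟨v, hv⟩ : ∃ v, v ∉ s := by
      by_contra! hall
      rw [eq_univ_of_forall hall, ncard_univ, Nat.card_eq_fintype_card] at hs
      omega
    exact ⟨⟨v, (hverts v).2 hv⟩⟩
  refine { preconnected := fun u w => ?_, nonempty := hne }
  by_contra huw
  refine hmax.not_isSeparated (x := x) (y := y) (A := Subtype.val '' {v | H.coe.Reachable u v})
    (B := Subtype.val '' {v | ¬ H.coe.Reachable u v}) (fun v hv => ?_) ⟨?_, ?_, ?_, ?_⟩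
  · refine hxy (not_not.1 fun hvs => hv ?_)
    rw [← image_union]
    exact ⟨⟨v, (hverts v).2 hvs⟩, em _, rfl⟩
  · exact ⟨u, u, SimpleGraph.Reachable.refl u, rfl⟩
  · exact ⟨w, w, huw, rfl⟩
  · rw [disjoint_image_iff Subtype.val_injective]
    exact disjoint_left.2 fun v hv hv' => hv' hv
  · rintro _ ⟨a, ha, rfl⟩ _ ⟨b, hb, rfl⟩ hab
    exact hb (SimpleGraph.Reachable.trans ha (hadj a b hab).reachable)

end
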